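/- A vector h=(1,h1,h2,h3) ∈ ℤ^4 is the h-vector of a 2-dimensional Buchsbaum simplicial complex if and only if there exist a vector h'=(1,h1',h2',h3') ∈ ℤ^4 with 0 ≤ h1', 0 ≤ h2' ≤ C(h1'+1,2), and −(1/3)·h2' ≤ h3' ≤ h2'^⟨2⟩, and an integer k ≥ 0, such that h = h' + (0,3k,−3k,k). -/

import Mathlib

open Finset

noncomputable section

/-- `Δ` is a simplicial complex on `[n] = {1,…,n}`: a collection of subsets of `[n]`,
closed under taking subsets, containing every singleton `{i}` for `i ∈ [n]`. -/
def IsComplexOn (n : ℕ) (Δ : Finset (Finset ℕ)) : Prop :=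
  (∀ F ∈ Δ, ∀ G ⊆ F, G ∈ Δ) ∧
  (∀ F ∈ Δ, ∀ i ∈ F, i ∈ Finset.Icc 1 n) ∧
  (∀ i ∈ Finset.Icc 1 n, ({i} : Finset ℕ) ∈ Δ)

/-- a simplicial complex whose vertex set is contained in `[n]`:
a downward closed collection of subsets of `[n]`. -/
def IsComplexIn (n : ℕ) (Δ : Finset (Finset ℕ)) : Prop :=
  (∀ F ∈ Δ, ∀ G ⊆ F, G ∈ Δ) ∧ (∀ F ∈ Δ, ∀ i ∈ F, i ∈ Finset.Icc 1 n)

/-- the faces of `Δ` with `m` vertices -/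
def facesOf (Δ : Finset (Finset ℕ)) (m : ℕ) : Finset (Finset ℕ) :=
  Δ.filter fun F => F.card = m

/-- `fVec Δ j = f_{j-1}(Δ)`, the number of faces of `Δ` with `j` vertices;
by convention `f_{-1}(Δ) = 1`. -/
def fVec (Δ : Finset (Finset ℕ)) (j : ℕ) : ℤ :=
  if j = 0 then 1 else ((facesOf Δ j).card : ℤ)

/-- the `h`-vector of a `(d-1)`-dimensional complex, defined by
`∑ f_{i-1} (x-1)^{d-i} = ∑ h_i x^{d-i}`, i.e.
`h_i = ∑_{j=0}^{i} (-1)^{i-j} C(d-j, i-j) f_{j-1}`. -/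
def hVec (d : ℕ) (Δ : Finset (Finset ℕ)) (i : ℕ) : ℤ :=
  ∑ j ∈ Finset.range (i + 1),
    (-1 : ℤ) ^ (i - j) * ((d - j).choose (i - j) : ℤ) * fVec Δ j

/-- the dimension `max {k : f_k(Δ) ≠ 0}` of `Δ`, as an integer -/
def dimZ (Δ : Finset (Finset ℕ)) : ℤ := ((Δ.sup Finset.card : ℕ) : ℤ) - 1

/-- the link `lk_Δ(F) = {G : G ∩ F = ∅, G ∪ F ∈ Δ}` -/
def link (Δ : Finset (Finset ℕ)) (F : Finset ℕ) : Finset (Finset ℕ) :=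
  Δ.filter fun G => Disjoint G F ∧ G ∪ F ∈ Δ

variable (K : Type) [Field K]

/-- the simplicial boundary operator on formal `K`-linear combinations of
finite subsets of `ℕ` (vertices ordered by the order on `ℕ`):
`∂ F = ∑_{v ∈ F} (-1)^{#{u ∈ F : u < v}} (F \ {v})`. -/
def bdry : (Finset ℕ →₀ K) →ₗ[K] (Finset ℕ →₀ K) :=
  Finsupp.lsum K fun F => LinearMap.toSpanSingleton K (Finset ℕ →₀ K)
    (∑ v ∈ F, ((-1 : K) ^ ((F.filter fun u => u < v).card)) • Finsupp.single (F.erase v) (1 : K))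

/-- the space of simplicial `K`-chains of `Δ` spanned by the faces with `m` vertices
(for `m = 0` this is the span of the empty face, giving *reduced* homology) -/
def chains (Δ : Finset (Finset ℕ)) (m : ℕ) : Submodule K (Finset ℕ →₀ K) :=
  Submodule.span K ((fun F => Finsupp.single F (1 : K)) '' (facesOf Δ m : Set (Finset ℕ)))

/-- the dimension of the reduced homology of `Δ` at faces of cardinality `m`:
`dim (ker ∂ ∩ C_m) - dim (∂ C_{m+1})` -/
def homDim (Δ : Finset (Finset ℕ)) (m : ℕ) : ℕ :=
  Module.finrank K ↥(chains K Δ m ⊓ LinearMap.ker (bdry K))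
    - Module.finrank K ↥((chains K Δ (m + 1)).map (bdry K))

/-- the reduced Betti number `β_i(Δ; K) = dim_K H̃_i(Δ; K)` for `i : ℤ` -/
def betti (Δ : Finset (Finset ℕ)) (i : ℤ) : ℕ :=
  if 0 ≤ i + 1 then homDim K Δ (i + 1).toNat else 0

/-- all facets (maximal faces) of `Δ` have the same cardinality -/
def IsPure (Δ : Finset (Finset ℕ)) : Prop :=
  ∀ F ∈ Δ, (∀ G ∈ Δ, F ⊆ G → F = G) → F.card = Δ.sup Finset.card

/-- `Δ` is Cohen–Macaulay (over `K`): for every face `F ∈ Δ` (including `∅`),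
`β_i(lk_Δ(F)) = 0` for all `i ≠ dim Δ - |F|`. -/
def IsCohenMacaulay (Δ : Finset (Finset ℕ)) : Prop :=
  ∀ F ∈ Δ, ∀ i : ℤ, i ≠ dimZ Δ - F.card → betti K (link Δ F) i = 0

/-- `Δ` is Buchsbaum (over `K`): `Δ` is pure and the link of every vertex is
Cohen–Macaulay. -/
def IsBuchsbaum (Δ : Finset (Finset ℕ)) : Prop :=
  IsPure Δ ∧ ∀ v : ℕ, ({v} : Finset ℕ) ∈ Δ → IsCohenMacaulay K (link Δ {v})

/-- `Δ` is connected: any two vertices are joined by a path of edges of `Δ` -/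
def IsConnectedComplex (Δ : Finset (Finset ℕ)) : Prop :=
  ∀ u v : ℕ, ({u} : Finset ℕ) ∈ Δ → ({v} : Finset ℕ) ∈ Δ →
    Relation.ReflTransGen (fun a b : ℕ => a ≠ b ∧ ({a, b} : Finset ℕ) ∈ Δ) u v

/-- `Δ` is link-acyclic: `β_i(lk_Δ(v)) = 0` for every vertex `v` of `Δ` and every `i` -/
def IsLinkAcyclic (Δ : Finset (Finset ℕ)) : Prop :=
  ∀ v : ℕ, ({v} : Finset ℕ) ∈ Δ → ∀ i : ℤ, betti K (link Δ {v}) i = 0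

/-- `Δ` is `2`-dimensional with `h`-vector `(a, b, c, e)` -/
def hVector3 (Δ : Finset (Finset ℕ)) (a b c e : ℤ) : Prop :=
  hVec 3 Δ 0 = a ∧ hVec 3 Δ 1 = b ∧ hVec 3 Δ 2 = c ∧ hVec 3 Δ 3 = e

/-- `macaulay2 a = a^⟨2⟩`: if `a = C(b,2) + r` is the (greedy) `2`-nd Macaulay
representation (`b` maximal with `C(b,2) ≤ a`, `0 ≤ r < b`, `r = C(r,1)`), then
`a^⟨2⟩ = C(b+1,3) + C(r+1,2)`, and `0^⟨2⟩ = 0`. -/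
def macaulay2 (a : ℕ) : ℕ :=
  if a = 0 then 0
  else
    (Nat.findGreatest (fun t => t.choose 2 ≤ a) (a + 2) + 1).choose 3
      + (a - (Nat.findGreatest (fun t => t.choose 2 ≤ a) (a + 2)).choose 2 + 1).choose 2

/-- `modRep n i = ī`, the unique element of `[n] = {1,…,n}` congruent to `i` mod `n` -/
def modRep (n : ℕ) (i : ℤ) : ℕ := ((i - 1) % (n : ℤ)).toNat + 1


end

lemma macaulay2_eq {b r : ℕ} (hr : r ≤ b) :
    macaulay2 (b.choose 2 + r) = (b + 1).choose 3 + (r + 1).choose 2 := by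
  have key : ∀ b r : ℕ, 1 ≤ b → r < b →
      macaulay2 (b.choose 2 + r) = (b + 1).choose 3 + (r + 1).choose 2 := by
    intro b r hb hr
    have hsucc : (b + 1).choose 2 = b.choose 2 + b := by
      rw [Nat.choose_succ_succ' b 1]; simp [add_comm]
    have hfg : Nat.findGreatest (fun t => t.choose 2 ≤ b.choose 2 + r) (b.choose 2 + r + 2) = b := by
      rw [Nat.findGreatest_eq_iff]
      refine ⟨?_, fun _ => Nat.le_add_right _ _, fun {m} hm _ hle => ?_⟩
      · have h2 : b ≤ b.choose 2 + 1 := by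
          clear hsucc hr
          induction b, hb using Nat.le_induction with
          | base => simp
          | succ n hn ih =>
            rw [Nat.choose_succ_succ' n 1, Nat.choose_one_right]; omega
        omega
      · have := Nat.choose_le_choose 2 (show b + 1 ≤ m from hm)
        omega
    unfold macaulay2
    rw [hfg]
    split_ifs with h0
    · have hr0 : r = 0 := by omega
      have hb0 : b.choose 2 = 0 := by omega
      have : b < 2 := by
        by_contra h
        exact (Nat.choose_pos (not_lt.mp h)).ne' hb0
      obtain rfl : b = 1 := by omega
      subst hr0; rfl
    · simp
  rcases Nat.eq_zero_or_pos b with rfl | hb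
  · obtain rfl : r = 0 := by omega
    simp [macaulay2, Nat.choose_eq_zero_of_lt]
  rcases hr.lt_or_eq with h | rfl
  · exact key b r hb h
  · have := key (r + 1) 0 (by omega) (by omega)
    have h1 : (r + 1).choose 2 = r.choose 2 + r := by
      rw [Nat.choose_succ_succ' r 1]; simp [add_comm]
    have h2 : (r + 2).choose 3 = (r + 1).choose 3 + (r + 1).choose 2 := by
      rw [Nat.choose_succ_succ' (r + 1) 2]; ring
    rw [h1] at this
    simpa [h2] using this

lemma exists_eq_choose_two_add (a : ℕ) : ∃ b r : ℕ, r < b ∧ a = b.choose 2 + r := by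
  induction a with
  | zero => exact ⟨1, 0, by simp⟩
  | succ a ih =>
    obtain ⟨b, r, hr, rfl⟩ := ih
    rcases Nat.lt_or_ge (r + 1) b with h | h
    · exact ⟨b, r + 1, h, by ring⟩
    · refine ⟨b + 1, 0, by omega, ?_⟩
      rw [Nat.choose_succ_succ' b 1]; simp; omega

lemma choose_two_succ (m : ℕ) : (m + 1).choose 2 = m.choose 2 + m := by
  rw [Nat.choose_succ_succ' m 1]; simp [add_comm]

lemma two_mul_choose_two_succ (m : ℕ) : 2 * (m + 1).choose 2 = m * (m + 1) := by
  induction m with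
  | zero => simp
  | succ m ih => rw [choose_two_succ]; linarith [ih]

lemma macaulay2_add_one_le (c i : ℕ) : macaulay2 c + i ≤ macaulay2 (c + i) := by
  induction i with
  | zero => simp
  | succ i ih =>
    obtain ⟨b, r, hr, h⟩ := exists_eq_choose_two_add (c + i)
    rw [h, macaulay2_eq hr.le] at ih
    rw [show c + (i + 1) = c + i + 1 from rfl, h, add_assoc (b.choose 2), macaulay2_eq (show r + 1 ≤ b by omega),
      choose_two_succ (r + 1)]
    omega

lemma macaulay2_add_le {c s x : ℕ} (h₁ : x ≤ (s + 1).choose 2) (h₂ : x ≤ s + c) :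
    macaulay2 c + x ≤ macaulay2 (c + s) := by
  obtain ⟨b, r, hr, rfl⟩ := exists_eq_choose_two_add c
  rw [macaulay2_eq hr.le]
  have h3 : (b + 2).choose 3 = (b + 1).choose 3 + (b + 1).choose 2 := by
    rw [Nat.choose_succ_succ' (b + 1) 2]; ring
  have hb := choose_two_succ b
  rcases Nat.lt_or_ge (b - r) s with hs | hs
  · rcases Nat.lt_or_ge b s with hbs | hbs
    · obtain ⟨i, rfl⟩ : ∃ i, s = b + 1 + i := ⟨s - b - 1, by omega⟩
      have e1 : b.choose 2 + r + (b + 1 + i) = (b + 1).choose 2 + (r + 1) + i := by omega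
      have := macaulay2_add_one_le ((b + 1).choose 2 + (r + 1)) i
      rw [macaulay2_eq (show r + 1 ≤ b + 1 by omega), choose_two_succ (r + 1)] at this
      rw [e1]
      simp only [add_assoc, Nat.reduceAdd] at *
      omega
    · obtain ⟨s', rfl⟩ : ∃ s', s = s' + (b - r) := ⟨s - (b - r), by omega⟩
      obtain ⟨p, rfl⟩ : ∃ p, b = r + p := ⟨b - r, by omega⟩
      obtain ⟨q, rfl⟩ : ∃ q, r = s' + q := ⟨r - s', by omega⟩
      simp only [Nat.add_sub_cancel_left] at *
      have e1 : (s' + q + p).choose 2 + (s' + q) + (s' + p) = (s' + q + p + 1).choose 2 + s' := by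
        omega
      rw [e1, macaulay2_eq (show s' ≤ s' + q + p + 1 by omega)]
      have t1 := two_mul_choose_two_succ (s' + q + p)
      have t2 := two_mul_choose_two_succ s'
      have t3 := two_mul_choose_two_succ (s' + q)
      have t4 := two_mul_choose_two_succ (s' + p)
      simp only [add_assoc, Nat.reduceAdd] at *
      nlinarith [Nat.zero_le (p * q)]
  · rw [add_assoc (b.choose 2), macaulay2_eq (show r + s ≤ b by omega)]
    have t1 := two_mul_choose_two_succ (r + s)
    have t2 := two_mul_choose_two_succ r
    have t3 := two_mul_choose_two_succ s
    nlinarith [Nat.zero_le (r * s)]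

section Homology

variable {K : Type} [Field K]

/-- Connectivity of the `1`-skeleton, phrased by cuts: every property of vertices that is
invariant along edges is constant. -/
def CutConnected (L : Finset (Finset ℕ)) : Prop :=
  ∀ P : ℕ → Prop, (∀ a b, a ≠ b → {a, b} ∈ L → (P a ↔ P b)) →
    ∀ a b, {a} ∈ L → {b} ∈ L → (P a ↔ P b)

lemma bdry_single_singleton (a : ℕ) :
    bdry K (Finsupp.single {a} 1) = Finsupp.single ∅ 1 := by
  simp [bdry, Finset.filter_singleton]

lemma bdry_single_pair {a b : ℕ} (h : a < b) :
    bdry K (Finsupp.single {a, b} 1) = Finsupp.single {b} 1 - Finsupp.single {a} 1 := by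
  have h1 : ({a, b} : Finset ℕ).erase a = {b} := by
    ext x; simp; omega
  have h2 : ({a, b} : Finset ℕ).erase b = {a} := by
    ext x; simp; omega
  simp [bdry, Finset.sum_pair h.ne, h1, h2, Finset.filter_insert, Finset.filter_singleton, h,
    h.not_gt, sub_eq_add_neg]

instance finiteDimensional_chains (L : Finset (Finset ℕ)) (m : ℕ) :
    FiniteDimensional K (chains K L m) :=
  FiniteDimensional.span_of_finite K ((facesOf L m).finite_toSet.image _)

lemma single_mem_chains {L : Finset (Finset ℕ)} {m : ℕ} {F : Finset ℕ} (hF : F ∈ L)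
    (hm : F.card = m) : Finsupp.single F (1 : K) ∈ chains K L m :=
  Submodule.subset_span ⟨F, by simp [facesOf, hF, hm], rfl⟩

lemma single_sub_single_mem {L : Finset (Finset ℕ)} {a b : ℕ} (hab : a ≠ b) (h : {a, b} ∈ L) :
    (Finsupp.single {a} 1 - Finsupp.single {b} 1 : Finset ℕ →₀ K) ∈
      (chains K L 2).map (bdry K) := by
  rcases lt_or_gt_of_ne hab with hlt | hlt
  · rw [← neg_sub, ← bdry_single_pair hlt]
    exact neg_mem (Submodule.mem_map_of_mem (single_mem_chains h (card_pair hab)))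
  · rw [← bdry_single_pair hlt]
    rw [pair_comm] at h
    exact Submodule.mem_map_of_mem (single_mem_chains h (card_pair hab.symm))

lemma boundaries_le_cycles (L : Finset (Finset ℕ)) (hL : ∀ F ∈ L, ∀ G ⊆ F, G ∈ L) :
    (chains K L 2).map (bdry K) ≤ chains K L 1 ⊓ LinearMap.ker (bdry K) := by
  rw [chains, Submodule.map_span, Submodule.span_le]
  rintro _ ⟨_, ⟨F, hF, rfl⟩, rfl⟩
  simp only [facesOf, coe_filter, Set.mem_ofPred_eq] at hF
  obtain ⟨hF, hc⟩ := hF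
  have aux : ∀ a b : ℕ, a < b → {a, b} ∈ L → bdry K (Finsupp.single {a, b} 1) ∈
      chains K L 1 ⊓ LinearMap.ker (bdry K) := by
    intro a b hab h
    rw [bdry_single_pair hab, Submodule.mem_inf, LinearMap.mem_ker, map_sub,
      bdry_single_singleton, bdry_single_singleton, sub_self]
    exact ⟨sub_mem (single_mem_chains (hL _ h _ (by simp)) rfl)
      (single_mem_chains (hL _ h _ (by simp)) rfl), rfl⟩
  obtain ⟨a, b, hab, rfl⟩ := card_eq_two.mp hc
  rcases lt_or_gt_of_ne hab with hlt | hlt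
  · exact aux a b hlt hF
  · rw [pair_comm] at hF ⊢
    exact aux b a hlt hF

lemma cutConnected_of_betti_zero {L : Finset (Finset ℕ)} (hL : ∀ F ∈ L, ∀ G ⊆ F, G ∈ L)
    (h : betti K L 0 = 0) : CutConnected L := by
  classical
  intro P hP
  suffices H : ∀ a b, {a} ∈ L → {b} ∈ L → P a → P b from fun a b ha hb => ⟨H a b ha hb, H b a hb ha⟩
  intro a b ha hb hPa
  by_contra hPb
  let φ : (Finset ℕ →₀ K) →ₗ[K] K :=
    Finsupp.lsum K fun F => LinearMap.toSpanSingleton K K (if ∃ c, F = {c} ∧ P c then 1 else 0)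
  have hφ : ∀ c, φ (Finsupp.single {c} 1) = if P c then 1 else 0 := by
    intro c
    simp [φ]
  have hlt : (chains K L 2).map (bdry K) < chains K L 1 ⊓ LinearMap.ker (bdry K) := by
    refine lt_of_le_of_ne (boundaries_le_cycles L hL) fun heq => ?_
    have hker : (chains K L 2).map (bdry K) ≤ LinearMap.ker φ := by
      rw [chains, Submodule.map_span, Submodule.span_le]
      rintro _ ⟨_, ⟨F, hF, rfl⟩, rfl⟩
      simp only [facesOf, coe_filter, Set.mem_ofPred_eq] at hF
      obtain ⟨hF, hc⟩ := hF
      obtain ⟨x, y, hxy, rfl⟩ := card_eq_two.mp hc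
      have := hP x y hxy hF
      rcases lt_or_gt_of_ne hxy with hlt | hlt
      · simp [bdry_single_pair hlt, hφ, this]
      · rw [pair_comm]
        simp [bdry_single_pair hlt, hφ, this]
    have hz : (Finsupp.single {a} 1 - Finsupp.single {b} 1 : Finset ℕ →₀ K) ∈
        chains K L 1 ⊓ LinearMap.ker (bdry K) := by
      rw [Submodule.mem_inf, LinearMap.mem_ker, map_sub,
        bdry_single_singleton, bdry_single_singleton, sub_self]
      exact ⟨sub_mem (single_mem_chains ha rfl) (single_mem_chains hb rfl), rfl⟩
    rw [← heq] at hz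
    have := LinearMap.mem_ker.mp (hker hz)
    simp [hφ, hPa, hPb] at this
  have := Submodule.finrank_lt_finrank_of_lt hlt
  have h' : homDim K L 1 = 0 := by simpa [betti] using h
  exact absurd (Nat.sub_eq_zero_iff_le.mp h') this.not_ge

lemma homDim_eq_zero_of_le {L : Finset (Finset ℕ)} {m : ℕ}
    (h : chains K L m ⊓ LinearMap.ker (bdry K) ≤ (chains K L (m + 1)).map (bdry K)) :
    homDim K L m = 0 :=
  Nat.sub_eq_zero_of_le (Submodule.finrank_mono h)

lemma homDim_eq_zero_of_card_lt {L : Finset (Finset ℕ)} {m : ℕ} (h : ∀ F ∈ L, F.card < m) :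
    homDim K L m = 0 := by
  apply homDim_eq_zero_of_le
  have : facesOf L m = ∅ := filter_eq_empty_iff.mpr fun F hF => (h F hF).ne
  simp [chains, this]

lemma homDim_zero_eq_zero {L : Finset (Finset ℕ)} {a : ℕ} (ha : {a} ∈ L) :
    homDim K L 0 = 0 := by
  apply homDim_eq_zero_of_le
  refine inf_le_left.trans ?_
  rw [chains, Submodule.span_le]
  rintro _ ⟨F, hF, rfl⟩
  simp only [facesOf, coe_filter, Set.mem_ofPred_eq, card_eq_zero] at hF
  rw [hF.2]
  exact ⟨_, single_mem_chains ha rfl, bdry_single_singleton a⟩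

lemma homDim_one_eq_zero {L : Finset (Finset ℕ)} (hconn : CutConnected L) :
    homDim K L 1 = 0 := by
  by_cases hr : ∃ r, {r} ∈ L
  · obtain ⟨r, hr⟩ := hr
    apply homDim_eq_zero_of_le
    have key : ∀ x ∈ chains K L 1, x - (bdry K x ∅) • Finsupp.single {r} 1 ∈
        (chains K L 2).map (bdry K) := by
      intro x hx
      induction hx using Submodule.span_induction with
      | mem x hx =>
        obtain ⟨F, hF, rfl⟩ := hx
        simp only [facesOf, coe_filter, Set.mem_ofPred_eq] at hF
        obtain ⟨hF, hc⟩ := hF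
        obtain ⟨a, rfl⟩ := card_eq_one.mp hc
        have := hconn (fun c => (Finsupp.single {c} 1 - Finsupp.single {r} 1 : Finset ℕ →₀ K) ∈
          (chains K L 2).map (bdry K)) (by
            intro c d hcd h
            have h1 := single_sub_single_mem (K := K) hcd h
            constructor
            · intro h2
              simpa using sub_mem h2 h1
            · intro h2
              simpa using add_mem h2 h1) r a hr hF
        rw [bdry_single_singleton]
        simpa using this
      | zero => simp
      | add x y _ _ hx hy =>
        have := add_mem hx hy
        convert this using 1
        simp only [map_add, Finsupp.add_apply, add_smul]
        abel
      | smul c x _ hx =>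
        have := Submodule.smul_mem _ c hx
        convert this using 1
        simp only [map_smul, Finsupp.smul_apply, smul_sub, smul_smul, smul_eq_mul]
    rintro x ⟨hx, hker⟩
    have := key x hx
    rw [LinearMap.mem_ker.mp hker] at this
    simpa using this
  · apply homDim_eq_zero_of_le
    have : facesOf L 1 = ∅ := by
      refine filter_eq_empty_iff.mpr fun F hF hc => ?_
      obtain ⟨a, rfl⟩ := card_eq_one.mp hc
      exact hr ⟨a, hF⟩
    simp [chains, this]

lemma link_empty (L : Finset (Finset ℕ)) : link L ∅ = L := by
  simp [link]

lemma mem_link {Δ : Finset (Finset ℕ)} {F G : Finset ℕ} :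
    G ∈ link Δ F ↔ G ∈ Δ ∧ Disjoint G F ∧ G ∪ F ∈ Δ := by
  simp [link]

lemma dimZ_eq {L : Finset (Finset ℕ)} {m : ℕ} {G : Finset ℕ} (hG : G ∈ L) (hm : G.card = m)
    (hle : ∀ F ∈ L, F.card ≤ m) : L.sup Finset.card = m :=
  le_antisymm (Finset.sup_le hle) (hm ▸ Finset.le_sup (f := Finset.card) hG)

variable (K) in
lemma isCohenMacaulay_of_cutConnected {L : Finset (Finset ℕ)}
    (hL : ∀ F ∈ L, ∀ G ⊆ F, G ∈ L) (hpure : ∀ F ∈ L, ∃ G ∈ L, F ⊆ G ∧ G.card = 2)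
    (hle : ∀ F ∈ L, F.card ≤ 2) (hconn : CutConnected L) : IsCohenMacaulay K L := by
  intro F hF i hi
  obtain ⟨G, hG, hFG, hGc⟩ := hpure F hF
  rw [dimZ, dimZ_eq hG hGc hle] at hi
  rw [betti]
  split_ifs with h0
  swap
  · rfl
  have hcard : F.card ≤ 2 := hle F hF
  obtain ⟨m, rfl⟩ : ∃ m : ℕ, i = m - 1 := ⟨(i + 1).toNat, by omega⟩
  rw [show ((m : ℤ) - 1 + 1).toNat = m by omega]
  rcases lt_or_ge (2 - F.card) m with hm | hm
  · refine homDim_eq_zero_of_card_lt fun H hH => ?_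
    obtain ⟨-, hd, hu⟩ := mem_link.mp hH
    have := hle _ hu
    rw [card_union_of_disjoint hd] at this
    omega
  · rcases Nat.eq_zero_or_pos m with rfl | hpos
    · obtain ⟨a, haG, haF⟩ : ∃ a ∈ G, a ∉ F := by
        by_contra! hcon
        have := card_le_card (show G ⊆ F from hcon)
        push_cast at hi
        omega
      refine homDim_zero_eq_zero (a := a) (mem_link.mpr ⟨hL G hG _ (by simpa using haG),
        by simpa using haF, hL G hG _ (union_subset (by simpa using haG) hFG)⟩)
    · have hF0 : F.card = 0 := by omega
      obtain rfl := card_eq_zero.mp hF0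
      obtain rfl : m = 1 := by simp at hi; omega
      rw [link_empty]
      exact homDim_one_eq_zero hconn

end Homology

section UpperBound

/-- The number of members of the family `𝓕` contained in `W`. -/
def inCount (𝓕 : Finset (Finset ℕ)) (W : Finset ℕ) : ℕ := (𝓕.filter (· ⊆ W)).card

variable {E T : Finset (Finset ℕ)} {V : Finset ℕ}

lemma inCount_union {𝓕 : Finset (Finset ℕ)} {A B : Finset ℕ} (hAB : Disjoint A B)
    (hne : ∀ F ∈ 𝓕, F.Nonempty) (h : ∀ F ∈ 𝓕, F ⊆ A ∪ B → F ⊆ A ∨ F ⊆ B) :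
    inCount 𝓕 (A ∪ B) = inCount 𝓕 A + inCount 𝓕 B := by
  rw [inCount, inCount, inCount, ← card_union_of_disjoint]
  · congr 1
    ext F
    simp only [mem_filter, mem_union]
    constructor
    · rintro ⟨h1, h2⟩
      rcases h F h1 h2 with h3 | h3 <;> simp [h1, h3]
    · rintro (⟨h1, h2⟩ | ⟨h1, h2⟩)
      · exact ⟨h1, h2.trans subset_union_left⟩
      · exact ⟨h1, h2.trans subset_union_right⟩
  · rw [disjoint_left]
    intro F hA hB
    simp only [mem_filter] at hA hB
    obtain ⟨x, hx⟩ := hne F hA.1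
    exact (disjoint_left.mp hAB) (hA.2 hx) (hB.2 hx)

lemma inCount_le_choose (hE : ∀ F ∈ E, F.card = 2) (S : Finset ℕ) :
    inCount E S ≤ S.card.choose 2 := by
  rw [← card_powersetCard]
  refine card_le_card fun F hF => ?_
  simp only [mem_filter] at hF
  exact mem_powersetCard.mpr ⟨hF.2, hE F hF.1⟩

lemma inCount_insert (hE : ∀ F ∈ E, F.card = 2) {v : ℕ} {W : Finset ℕ} (hv : v ∉ W) :
    inCount E (insert v W) = inCount E W + (W.filter fun u => {u, v} ∈ E).card := by
  have : E.filter (· ⊆ insert v W) =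
      E.filter (· ⊆ W) ∪ (W.filter fun u => {u, v} ∈ E).image fun u => {u, v} := by
    ext F
    simp only [mem_filter, mem_union, mem_image]
    constructor
    · rintro ⟨hF, hsub⟩
      by_cases hvF : v ∈ F
      · obtain ⟨a, b, hab, rfl⟩ := card_eq_two.mp (hE F hF)
        right
        simp only [insert_subset_iff, mem_insert, singleton_subset_iff, mem_singleton] at hsub hvF
        rcases hvF with rfl | rfl
        · exact ⟨b, ⟨hsub.2.resolve_left hab.symm, by rwa [pair_comm]⟩, pair_comm _ _⟩
        · exact ⟨a, ⟨hsub.1.resolve_left hab, hF⟩, rfl⟩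
      · exact Or.inl ⟨hF, (subset_insert_iff_of_notMem hvF).mp hsub⟩
    · rintro (⟨h1, h2⟩ | ⟨u, ⟨h1, h2⟩, rfl⟩)
      · exact ⟨h1, h2.trans (subset_insert _ _)⟩
      · exact ⟨h2, by simp [insert_subset_iff, h1]⟩
  rw [inCount, this, card_union_of_disjoint, card_image_of_injOn, inCount]
  · intro a ha b hb hab
    have : a ∈ ({b, v} : Finset ℕ) := by
      rw [← show ({a, v} : Finset ℕ) = {b, v} from hab]; simp
    have hav : a ≠ v := by
      rintro rfl
      simp only [coe_filter, Set.mem_ofPred_eq] at ha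
      exact hv ha.1
    simpa [hav] using this
  · rw [disjoint_left]
    intro F h1 h2
    simp only [mem_filter, mem_image] at h1 h2
    obtain ⟨u, -, rfl⟩ := h2
    exact hv (h1.2 (by simp))

lemma inCount_insert_le (hT : ∀ F ∈ T, ∀ a ∈ F, ∀ b ∈ F, a ≠ b → {a, b} ∈ E)
    (hT3 : ∀ F ∈ T, F.card = 3) {v : ℕ} {W : Finset ℕ} :
    inCount T (insert v W) ≤ inCount T W + inCount E (W.filter fun u => {u, v} ∈ E) := by
  have hsplit : T.filter (· ⊆ insert v W) =
      T.filter (· ⊆ W) ∪ (T.filter (· ⊆ insert v W)).filter (v ∈ ·) := by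
    ext F
    simp only [mem_filter, mem_union]
    constructor
    · rintro ⟨h1, h2⟩
      by_cases hvF : v ∈ F
      · exact Or.inr ⟨⟨h1, h2⟩, hvF⟩
      · exact Or.inl ⟨h1, (subset_insert_iff_of_notMem hvF).mp h2⟩
    · rintro (⟨h1, h2⟩ | ⟨h, -⟩)
      · exact ⟨h1, h2.trans (subset_insert _ _)⟩
      · exact h
  rw [inCount, hsplit]
  refine (card_union_le _ _).trans (Nat.add_le_add_left ?_ _)
  refine card_le_card_of_injOn (fun F => F.erase v) ?_ ?_
  · intro F hF
    simp only [coe_filter, mem_filter, Set.mem_ofPred_eq] at hF ⊢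
    obtain ⟨⟨hF, hsub⟩, hvF⟩ := hF
    have hc : (F.erase v).card = 2 := by rw [card_erase_of_mem hvF, hT3 F hF]
    constructor
    · obtain ⟨a, b, hab, he⟩ := card_eq_two.mp hc
      have ha : a ∈ F.erase v := by rw [he]; simp
      have hb : b ∈ F.erase v := by rw [he]; simp
      rw [he]
      exact hT F hF a (mem_of_mem_erase ha) b (mem_of_mem_erase hb) hab
    · intro u hu
      have huF := mem_of_mem_erase hu
      have huv := ne_of_mem_erase hu
      exact mem_filter.mpr ⟨(mem_insert.mp (hsub huF)).resolve_left huv,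
        hT F hF u huF v hvF huv⟩
  · intro F hF G hG h
    simp only [coe_filter, mem_filter, Set.mem_ofPred_eq] at hF hG
    rw [← insert_erase hF.2, ← insert_erase hG.2]
    exact congrArg _ h

/-- The numerical invariants of a union `W` of `κ` growing pieces of a complex with edges `E` and
triangles `T`, the set `D` being the union of the pieces that are already complete. -/
def GrowthInvariant (E T : Finset (Finset ℕ)) (W : Finset ℕ) (κ a M : ℕ) (D : Finset ℕ) : Prop :=
  D ⊆ W ∧ 3 * κ ≤ D.card + 3 ∧ (∀ u ∈ D, ∀ w ∉ D, {u, w} ∉ E) ∧ W.card = M + 3 * κ ∧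
    inCount E W + 3 * κ = 2 * W.card + a ∧ a ≤ (M + 1).choose 2 ∧
    inCount T W + 2 * κ ≤ W.card + a + macaulay2 a ∧
    (∀ S ⊆ W, 2 ≤ S.card → inCount E S + 3 ≤ 2 * S.card + a) ∧
    (∀ u ∈ W, ∃ w ∈ W, {u, w} ∈ E) ∧ (κ = 0 → W = ∅)

lemma GrowthInvariant.insert (hE : ∀ F ∈ E, F.card = 2)
    (hT : ∀ F ∈ T, ∀ a ∈ F, ∀ b ∈ F, a ≠ b → {a, b} ∈ E) (hT3 : ∀ F ∈ T, F.card = 3)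
    {W D : Finset ℕ} {κ a M : ℕ} (h : GrowthInvariant E T W κ a M D) {v x y : ℕ} (hv : v ∉ W)
    (hx : x ∈ W) (hy : y ∈ W) (hxy : x ≠ y) (hxv : {x, v} ∈ E) (hyv : {y, v} ∈ E) :
    ∃ a', GrowthInvariant E T (insert v W) κ a' (M + 1) D := by
  obtain ⟨hDW, hκ, hD, hW, he, ha, ht, hS, hnb, h0⟩ := h
  set N := W.filter fun u => {u, v} ∈ E with hN
  have hN2 : 2 ≤ N.card := by
    rw [← card_pair hxy]
    refine card_le_card ?_
    simp [insert_subset_iff, hN, hx, hy, hxv, hyv]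
  obtain ⟨s, hs⟩ : ∃ s, N.card = s + 2 := ⟨N.card - 2, by omega⟩
  have hNW : N ⊆ W := filter_subset _ _
  have hND : N.card + D.card ≤ W.card := by
    rw [← card_union_of_disjoint]
    · exact card_le_card (union_subset hNW hDW)
    · rw [disjoint_left]
      intro u hu huD
      exact hD u huD v (fun h => hv (hDW h)) (mem_filter.mp hu).2
  have hei := inCount_insert hE hv
  have hti := inCount_insert_le hT hT3 (v := v) (W := W)
  rw [← hN] at hei hti
  have hc1 := inCount_le_choose hE N
  have hc2 := hS N hNW hN2
  rw [hs] at hc1 hc2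
  have hch : (s + 2).choose 2 = (s + 1).choose 2 + s + 1 := choose_two_succ (s + 1)
  have hmac : macaulay2 a + (inCount E N - (s + 1)) ≤ macaulay2 (a + s) :=
    macaulay2_add_le (by omega) (by omega)
  have hcard : (Insert.insert v W).card = W.card + 1 := card_insert_of_notMem hv
  refine ⟨a + s, hDW.trans (subset_insert _ _), hκ, hD, by omega, by omega, ?_, by omega, ?_, ?_,
    ?_⟩
  · rw [choose_two_succ (M + 1)]
    omega
  · intro S hSW hS2
    by_cases hvS : v ∈ S
    · have hS' : S.erase v ⊆ W := by
        rwa [← subset_insert_iff]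
      have hvS' : v ∉ S.erase v := notMem_erase v S
      have hin := inCount_insert hE hvS'
      rw [insert_erase hvS] at hin
      have hle : ((S.erase v).filter fun u => {u, v} ∈ E).card ≤ s + 2 := by
        rw [← hs]
        exact card_le_card (filter_subset_filter _ hS')
      have hle' := card_filter_le (S.erase v) fun u => ({u, v} : Finset ℕ) ∈ E
      have hce := card_erase_of_mem hvS
      rcases Nat.lt_or_ge (S.erase v).card 2 with h2 | h2
      · have h3 := inCount_le_choose hE (S.erase v)
        have : (S.erase v).card = 1 := by omega
        rw [this] at h3 hle'
        simp at h3
        omega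
      · have := hS _ hS' h2
        omega
    · have := hS S ((subset_insert_iff_of_notMem hvS).mp hSW) hS2
      omega
  · intro u hu
    rcases mem_insert.mp hu with rfl | hu
    · exact ⟨x, mem_insert_of_mem hx, by rwa [pair_comm]⟩
    · obtain ⟨w, hw, h⟩ := hnb u hu
      exact ⟨w, mem_insert_of_mem hw, h⟩
  · intro hk
    rw [h0 hk] at hx
    simp at hx

lemma GrowthInvariant.union_triangle (hE : ∀ F ∈ E, F.card = 2)
    (hT : ∀ F ∈ T, ∀ a ∈ F, ∀ b ∈ F, a ≠ b → {a, b} ∈ E) (hT3 : ∀ F ∈ T, F.card = 3)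
    {W D t : Finset ℕ} {κ a M : ℕ} (h : GrowthInvariant E T W κ a M D)
    (hclosed : ∀ u ∈ W, ∀ w ∉ W, {u, w} ∉ E) (ht : t ∈ T) (htW : Disjoint W t) :
    GrowthInvariant E T (W ∪ t) (κ + 1) a M W := by
  obtain ⟨-, -, -, hW, he, ha, hti, hS, hnb, -⟩ := h
  have hsplit : ∀ F : Finset ℕ, (∀ a ∈ F, ∀ b ∈ F, a ≠ b → {a, b} ∈ E) → F ⊆ W ∪ t →
      F ⊆ W ∨ F ⊆ t := by
    intro F hF hsub
    by_cases hFt : F ⊆ t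
    · exact Or.inr hFt
    · left
      obtain ⟨u, huF, hut⟩ := not_subset.mp hFt
      have huW : u ∈ W := (mem_union.mp (hsub huF)).resolve_right hut
      intro w hwF
      by_contra hwW
      exact hclosed u huW w hwW (hF u huF w hwF (by rintro rfl; exact hwW huW))
  have hEpair : ∀ F ∈ E, ∀ a ∈ F, ∀ b ∈ F, a ≠ b → {a, b} ∈ E := by
    intro F hF a ha b hb hab
    have : ({a, b} : Finset ℕ) = F := eq_of_subset_of_card_le
      (by simp [insert_subset_iff, ha, hb]) (by rw [card_pair hab, hE F hF])
    rwa [this]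
  have hEne : ∀ F ∈ E, F.Nonempty := fun F hF => card_pos.mp (by rw [hE F hF]; norm_num)
  have hTne : ∀ F ∈ T, F.Nonempty := fun F hF => card_pos.mp (by rw [hT3 F hF]; norm_num)
  have htc := hT3 t ht
  have hcard : (W ∪ t).card = W.card + 3 := by rw [card_union_of_disjoint htW, htc]
  have h1 : inCount E (W ∪ t) = inCount E W + 3 := by
    rw [inCount_union htW hEne fun F hF => hsplit F (hEpair F hF)]
    congr 1
    have : E.filter (· ⊆ t) = powersetCard 2 t := by
      ext F
      simp only [mem_filter, mem_powersetCard]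
      constructor
      · rintro ⟨h1, h2⟩
        exact ⟨h2, hE F h1⟩
      · rintro ⟨h1, h2⟩
        obtain ⟨a, b, hab, rfl⟩ := card_eq_two.mp h2
        simp only [insert_subset_iff, singleton_subset_iff] at h1
        exact ⟨hT t ht a h1.1 b h1.2 hab, by simp [insert_subset_iff, h1]⟩
    rw [inCount, this, card_powersetCard, htc]
    rfl
  have h2 : inCount T (W ∪ t) ≤ inCount T W + 1 := by
    rw [inCount_union htW hTne fun F hF => hsplit F (hT F hF)]
    refine Nat.add_le_add_left (card_le_one.mpr fun F hF G hG => ?_) _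
    simp only [mem_filter] at hF hG
    rw [eq_of_subset_of_card_le hF.2 (by rw [htc, hT3 F hF.1]),
      eq_of_subset_of_card_le hG.2 (by rw [htc, hT3 G hG.1])]
  refine ⟨subset_union_left, by omega, hclosed, by omega, by omega, ha, by omega, ?_, ?_, by omega⟩
  · intro S hSW hS2
    have hSeq : S = S ∩ W ∪ S ∩ t := by
      rw [← inter_union_distrib_left, inter_eq_left.mpr hSW]
    have hdis : Disjoint (S ∩ W) (S ∩ t) :=
      htW.mono inter_subset_right inter_subset_right
    have hcu : S.card = (S ∩ W).card + (S ∩ t).card := by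
      rw [← card_union_of_disjoint hdis, ← hSeq]
    have hcount : inCount E S = inCount E (S ∩ W) + inCount E (S ∩ t) := by
      conv_lhs => rw [hSeq]
      refine inCount_union hdis hEne fun F hF hsub => ?_
      rw [← hSeq] at hsub
      rcases hsplit F (hEpair F hF) (hsub.trans hSW) with h | h
      · exact Or.inl (subset_inter hsub h)
      · exact Or.inr (subset_inter hsub h)
    have ht3 : (S ∩ t).card ≤ 3 := htc ▸ card_le_card inter_subset_right
    have hc := inCount_le_choose hE (S ∩ t)
    have hc' := inCount_le_choose hE (S ∩ W)
    have hSS := hS (S ∩ W) inter_subset_right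
    generalize (S ∩ t).card = p at *
    generalize (S ∩ W).card = q at *
    have hp : p.choose 2 ≤ 3 ∧ (p ≤ 2 → p.choose 2 ≤ 1) ∧ (p ≤ 1 → p.choose 2 = 0) := by
      interval_cases p <;> decide
    rcases Nat.lt_or_ge q 2 with hq | hq
    · have : q.choose 2 = 0 := Nat.choose_eq_zero_of_lt hq
      omega
    · have := hSS hq
      omega
  · intro u hu
    rcases mem_union.mp hu with hu | hu
    · obtain ⟨w, hw, h⟩ := hnb u hu
      exact ⟨w, mem_union_left _ hw, h⟩
    · obtain ⟨w, hw, hne⟩ := exists_mem_ne (by omega : 1 < t.card) u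
      exact ⟨w, mem_union_right _ hw, hT t ht u hu w hw hne.symm⟩

lemma exists_growthInvariant (hE : ∀ F ∈ E, F.card = 2) (hEV : ∀ F ∈ E, F ⊆ V)
    (hT : ∀ F ∈ T, ∀ a ∈ F, ∀ b ∈ F, a ≠ b → {a, b} ∈ E) (hT3 : ∀ F ∈ T, F.card = 3)
    (hcov : ∀ v ∈ V, ∃ t ∈ T, v ∈ t)
    (hlink : ∀ v ∈ V, ∀ P : ℕ → Prop, (∀ c d, c ≠ d → {v, c, d} ∈ T → (P c ↔ P d)) →
      ∀ a b, {v, a} ∈ E → {v, b} ∈ E → (P a ↔ P b)) :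
    ∃ κ a M D, GrowthInvariant E T V κ a M D := by
  have key : ∀ m W, W ⊆ V → (V \ W).card = m →
      (∃ κ a M D, GrowthInvariant E T W κ a M D) → ∃ κ a M D, GrowthInvariant E T V κ a M D := by
    intro m
    induction m using Nat.strong_induction_on with
    | _ m ih =>
      intro W hWV hm ⟨κ, a, M, D, h⟩
      rcases eq_or_ne W V with rfl | hne
      · exact ⟨κ, a, M, D, h⟩
      have hdec : ∀ W', W ⊆ W' → W' ⊆ V → ∀ z ∈ W', z ∉ W → (V \ W').card < m := by
        intro W' h1 h2 z hz hzW
        rw [← hm]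
        refine card_lt_card ⟨sdiff_subset_sdiff subset_rfl h1, fun hsub => ?_⟩
        have := hsub (mem_sdiff.mpr ⟨h2 hz, hzW⟩)
        simp [hz] at this
      have hsub2 : ∀ t ∈ T, t ⊆ V := by
        intro t ht u hu
        obtain ⟨w, hw, hne⟩ := exists_mem_ne (by rw [hT3 t ht]; norm_num : 1 < t.card) u
        exact hEV _ (hT t ht u hu w hw hne.symm) (by simp)
      by_cases hclosed : ∀ u ∈ W, ∀ w ∉ W, {u, w} ∉ E
      · obtain ⟨v, hvV, hvW⟩ : ∃ v ∈ V, v ∉ W := by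
          by_contra! hcon
          exact hne (hWV.antisymm hcon)
        obtain ⟨t, ht, hvt⟩ := hcov v hvV
        have hdisj : Disjoint W t := by
          rw [disjoint_left]
          intro u huW hut
          exact hclosed u huW v hvW (hT t ht u hut v hvt (by rintro rfl; exact hvW huW))
        have hU : W ∪ t ⊆ V := union_subset hWV (hsub2 t ht)
        exact ih _ (hdec (W ∪ t) subset_union_left hU v (mem_union_right _ hvt) hvW) (W ∪ t) hU rfl
          ⟨_, _, _, _, h.union_triangle hE hT hT3 hclosed ht hdisj⟩
      · push Not at hclosed
        obtain ⟨w, hw, w', hw', hedge⟩ := hclosed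
        obtain ⟨z, hz, hwz⟩ := h.2.2.2.2.2.2.2.2.1 w hw
        have := mt (hlink w (hWV hw) (· ∈ W) · z w' hwz hedge)
          (by simp [hz, hw'])
        push Not at this
        obtain ⟨c, d, hcd, hT', hP⟩ := this
        obtain ⟨c, d, hcd, hT', hc, hd⟩ : ∃ c d, c ≠ d ∧ {w, c, d} ∈ T ∧ c ∈ W ∧ d ∉ W := by
          rcases hP with ⟨hc, hd⟩ | ⟨hc, hd⟩
          · exact ⟨c, d, hcd, hT', hc, hd⟩
          · exact ⟨d, c, hcd.symm, by rwa [pair_comm], hd, hc⟩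
        have hwc : w ≠ c := by
          rintro rfl
          have := hT3 _ hT'
          simp [card_pair hcd] at this
        have hU : insert d W ⊆ V := insert_subset (hsub2 _ hT' (by simp)) hWV
        obtain ⟨a', h'⟩ := h.insert hE hT hT3 hd hw hc hwc
          (hT _ hT' w (by simp) d (by simp) (by rintro rfl; exact hd hw))
          (hT _ hT' c (by simp) d (by simp) hcd)
        exact ih _ (hdec _ (subset_insert _ _) hU d (by simp) hd) _ hU rfl ⟨_, _, _, _, h'⟩
  refine key _ ∅ (empty_subset _) rfl ⟨0, 0, 0, ∅, ?_⟩
  have h1 : inCount E ∅ = 0 := by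
    refine card_eq_zero.mpr (filter_eq_empty_iff.mpr fun F hF h => ?_)
    have := hE F hF
    simp [subset_empty.mp h] at this
  have h2 : inCount T ∅ = 0 := by
    refine card_eq_zero.mpr (filter_eq_empty_iff.mpr fun F hF h => ?_)
    have := hT3 F hF
    simp [subset_empty.mp h] at this
  refine ⟨by simp, by simp, by simp, by simp, by simp [h1], by simp, by simp [h2], ?_, by simp,
    by simp⟩
  intro S hS hc
  simp [subset_empty.mp hS] at hc

end UpperBound

section Necessity

lemma card_le_of_cut {G : Finset (Finset ℕ)} {N : Finset ℕ} (hG : ∀ F ∈ G, F ⊆ N)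
    (h : ∀ P : ℕ → Prop, (∀ c d, c ≠ d → {c, d} ∈ G → (P c ↔ P d)) →
      ∀ a ∈ N, ∀ b ∈ N, (P a ↔ P b)) : N.card ≤ G.card + 1 := by
  classical
  rcases N.eq_empty_or_nonempty with rfl | ⟨a, ha⟩
  · simp
  let 𝓢 := N.powerset.filter fun S => a ∈ S ∧ S.card ≤ (G.filter (· ⊆ S)).card + 1
  have hne : 𝓢.Nonempty := ⟨{a}, by simp [𝓢, ha]⟩
  obtain ⟨S, hS, hmax⟩ := exists_max_image 𝓢 Finset.card hne
  simp only [𝓢, mem_filter, mem_powerset] at hS hmax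
  obtain ⟨hSN, haS, hcard⟩ := hS
  by_cases hSN' : S = N
  · subst hSN'
    exact hcard.trans (by gcongr; exact filter_subset _ _)
  exfalso
  obtain ⟨b, hb, hbS⟩ : ∃ b ∈ N, b ∉ S := by
    by_contra! hcon
    exact hSN' (hSN.antisymm hcon)
  have step : ∀ c d, {c, d} ∈ G → c ∈ S → d ∉ S → False := by
    intro c d hcd hc hd
    have hd' : d ∈ N := hG _ hcd (by simp)
    have hlt : (G.filter (· ⊆ S)).card < (G.filter (· ⊆ insert d S)).card := by
      refine card_lt_card ⟨fun F hF => ?_, fun hcon => ?_⟩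
      · simp only [mem_filter] at hF ⊢
        exact ⟨hF.1, hF.2.trans (subset_insert _ _)⟩
      · have : {c, d} ∈ G.filter (· ⊆ S) := hcon (by simp [hcd, insert_subset_iff, hc])
        simp only [mem_filter] at this
        exact hd (this.2 (by simp))
    have := hmax (insert d S) ⟨insert_subset hd' hSN, mem_insert_of_mem haS, by
      rw [card_insert_of_notMem hd]; omega⟩
    rw [card_insert_of_notMem hd] at this
    omega
  refine hbS ((h (· ∈ S) (fun c d _ hcd => ?_) a ha b hb).mp haS)
  by_contra hcon
  by_cases hc : c ∈ S
  · exact step c d hcd hc fun hd => hcon (by simp [hc, hd])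
  · refine step d c (by rwa [pair_comm]) ?_ hc
    by_contra hd
    exact hcon (by simp [hc, hd])

lemma sum_card_filter_mem {𝓕 : Finset (Finset ℕ)} {V : Finset ℕ} {m : ℕ}
    (hV : ∀ F ∈ 𝓕, F ⊆ V) (hm : ∀ F ∈ 𝓕, F.card = m) :
    ∑ v ∈ V, (𝓕.filter (v ∈ ·)).card = m * 𝓕.card := by
  have := sum_card_bipartiteAbove_eq_sum_card_bipartiteBelow (s := V) (t := 𝓕)
    (fun v F => v ∈ F)
  simp only [bipartiteAbove, bipartiteBelow] at this
  rw [this, sum_congr rfl (g := fun _ => m), sum_const, smul_eq_mul, mul_comm]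
  intro F hF
  rw [filter_mem_eq_inter, inter_eq_right.mpr (hV F hF), hm F hF]

lemma two_mul_card_edges_le {E T : Finset (Finset ℕ)} {V : Finset ℕ}
    (hE : ∀ F ∈ E, F.card = 2) (hEV : ∀ F ∈ E, F ⊆ V)
    (hT : ∀ F ∈ T, ∀ a ∈ F, ∀ b ∈ F, a ≠ b → {a, b} ∈ E) (hT3 : ∀ F ∈ T, F.card = 3)
    (hTV : ∀ F ∈ T, F ⊆ V)
    (hlink : ∀ v ∈ V, ∀ P : ℕ → Prop, (∀ c d, c ≠ d → {v, c, d} ∈ T → (P c ↔ P d)) →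
      ∀ a b, {v, a} ∈ E → {v, b} ∈ E → (P a ↔ P b)) :
    2 * E.card ≤ 3 * T.card + V.card := by
  rw [← sum_card_filter_mem hEV hE, ← sum_card_filter_mem hTV hT3, card_eq_sum_ones,
    ← sum_add_distrib]
  refine sum_le_sum fun v hv => ?_
  have h1 : (E.filter (v ∈ ·)).card ≤ (V.filter fun u => {v, u} ∈ E).card := by
    refine (card_le_card (t := (V.filter fun u => {v, u} ∈ E).image fun u => {v, u})
      fun F hF => ?_).trans card_image_le
    simp only [mem_filter] at hF
    obtain ⟨hF, hvF⟩ := hF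
    obtain ⟨a, b, hab, rfl⟩ := card_eq_two.mp (hE F hF)
    have := hEV _ hF
    simp only [mem_insert, mem_singleton] at hvF
    rcases hvF with rfl | rfl
    · exact mem_image.mpr ⟨b, by simp [hF, this (show b ∈ {v, b} by simp)], rfl⟩
    · exact mem_image.mpr ⟨a, by simp [pair_comm v a, hF, this (show a ∈ {a, v} by simp)], pair_comm _ _⟩
  refine h1.trans ((card_le_of_cut (G := (T.filter (v ∈ ·)).image (·.erase v)) ?_ ?_).trans
    (Nat.add_le_add_right card_image_le 1))
  · simp only [mem_image, mem_filter, forall_exists_index, and_imp]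
    rintro _ F hF hvF rfl a ha
    simp only [mem_erase] at ha
    have := hT F hF v hvF a ha.2 ha.1.symm
    exact mem_filter.mpr ⟨hEV _ this (by simp), this⟩
  · intro P hP a ha b hb
    refine hlink v hv P (fun c d hcd h => hP c d hcd (mem_image.mpr ⟨_, mem_filter.mpr ⟨h, by simp⟩, ?_⟩))
      a b (mem_filter.mp ha).2 (mem_filter.mp hb).2
    refine erase_insert fun hv' => ?_
    rw [insert_eq_of_mem hv'] at h
    have := hT3 _ h
    have := card_le_two (a := c) (b := d)
    omega

variable {n : ℕ} {Δ : Finset (Finset ℕ)}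

lemma hVector3_iff (hΔ : IsComplexOn n Δ) (a b c e : ℤ) : hVector3 Δ a b c e ↔
    1 = a ∧ (n : ℤ) - 3 = b ∧ ((facesOf Δ 2).card : ℤ) - 2 * n + 3 = c ∧
      ((facesOf Δ 3).card : ℤ) - (facesOf Δ 2).card + n - 1 = e := by
  have h1 : (facesOf Δ 1).card = n := by
    have : facesOf Δ 1 = (Icc 1 n).image singleton := by
      ext F
      simp only [facesOf, mem_filter, mem_image, card_eq_one]
      constructor
      · rintro ⟨hF, a, rfl⟩
        exact ⟨a, hΔ.2.1 _ hF a (by simp), rfl⟩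
      · rintro ⟨a, ha, rfl⟩
        exact ⟨hΔ.2.2 a ha, a, rfl⟩
    rw [this, card_image_of_injective _ singleton_injective]
    simp
  have c32 : Nat.choose 3 2 = 3 := rfl
  simp only [hVector3, hVec, fVec, sum_range_succ, range_zero, sum_empty, h1, one_ne_zero,
    OfNat.ofNat_ne_zero, if_true, if_false]
  norm_num [c32]
  intro _
  constructor <;> rintro ⟨hb, hc, he⟩ <;> refine ⟨?_, ?_, ?_⟩ <;> linarith

lemma exists_superset_card_three (hd : dimZ Δ = 2) (hp : IsPure Δ) {F : Finset ℕ} (hF : F ∈ Δ) :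
    ∃ G ∈ Δ, F ⊆ G ∧ G.card = 3 := by
  obtain ⟨G, hG, hmax⟩ := exists_max_image (Δ.filter (F ⊆ ·)) Finset.card ⟨F, by simp [hF]⟩
  simp only [mem_filter] at hG hmax
  refine ⟨G, hG.1, hG.2, ?_⟩
  rw [hp G hG.1 fun H hH hGH => eq_of_subset_of_card_le hGH (hmax H ⟨hH, hG.2.trans hGH⟩)]
  simp only [dimZ] at hd
  omega

lemma card_le_three (hd : dimZ Δ = 2) {F : Finset ℕ} (hF : F ∈ Δ) : F.card ≤ 3 := by
  have := Finset.le_sup (f := Finset.card) hF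
  simp only [dimZ] at hd
  omega

lemma cutConnected_link {K : Type} [Field K] (hΔ : IsComplexOn n Δ) (hd : dimZ Δ = 2)
    (hB : IsBuchsbaum K Δ) {v : ℕ} (hv : {v} ∈ Δ) : CutConnected (link Δ {v}) := by
  have hdown : ∀ F ∈ link Δ {v}, ∀ G ⊆ F, G ∈ link Δ {v} := by
    intro F hF G hG
    rw [mem_link] at hF ⊢
    exact ⟨hΔ.1 _ hF.1 _ hG, disjoint_of_subset_left hG hF.2.1,
      hΔ.1 _ hF.2.2 _ (union_subset_union_left hG)⟩
  obtain ⟨G, hG, hvG, hGc⟩ := exists_superset_card_three hd hB.1 hv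
  have hvG : v ∈ G := by simpa using hvG
  have hmem : G.erase v ∈ link Δ {v} := by
    refine mem_link.mpr ⟨hΔ.1 _ hG _ (erase_subset _ _), by simp, ?_⟩
    rwa [union_singleton, insert_erase hvG]
  have hdim : (link Δ {v}).sup Finset.card = 2 := by
    refine dimZ_eq hmem (by rw [card_erase_of_mem hvG, hGc]) fun F hF => ?_
    rw [mem_link] at hF
    have := card_le_three hd hF.2.2
    rw [card_union_of_disjoint hF.2.1] at this
    simp only [card_singleton] at this
    omega
  have := hB.2 v hv ∅ (hdown _ hmem _ (empty_subset _)) 0 (by simp [dimZ, hdim])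
  rw [link_empty] at this
  exact cutConnected_of_betti_zero hdown this

lemma exists_of_isBuchsbaum {K : Type} [Field K] (hΔ : IsComplexOn n Δ) (hd : dimZ Δ = 2)
    (hB : IsBuchsbaum K Δ) :
    ∃ k a M : ℕ, n = M + 3 * (k + 1) ∧ (facesOf Δ 2).card + 3 * (k + 1) = 2 * n + a ∧
      a ≤ (M + 1).choose 2 ∧ (facesOf Δ 3).card + 2 * (k + 1) ≤ n + a + macaulay2 a ∧
      2 * (facesOf Δ 2).card ≤ 3 * (facesOf Δ 3).card + n := by
  have hE : ∀ F ∈ facesOf Δ 2, F.card = 2 := fun F hF => (mem_filter.mp hF).2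
  have hT3 : ∀ F ∈ facesOf Δ 3, F.card = 3 := fun F hF => (mem_filter.mp hF).2
  have hV : ∀ m, ∀ F ∈ facesOf Δ m, F ⊆ Icc 1 n := fun m F hF a ha =>
    hΔ.2.1 F (mem_filter.mp hF).1 a ha
  have hT : ∀ F ∈ facesOf Δ 3, ∀ a ∈ F, ∀ b ∈ F, a ≠ b → {a, b} ∈ facesOf Δ 2 := by
    intro F hF a ha b hb hab
    exact mem_filter.mpr ⟨hΔ.1 F (mem_filter.mp hF).1 _ (by simp [insert_subset_iff, ha, hb]),
      card_pair hab⟩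
  have hcov : ∀ v ∈ Icc 1 n, ∃ t ∈ facesOf Δ 3, v ∈ t := by
    intro v hv
    obtain ⟨G, hG, hvG, hc⟩ := exists_superset_card_three hd hB.1 (hΔ.2.2 v hv)
    exact ⟨G, mem_filter.mpr ⟨hG, hc⟩, by simpa using hvG⟩
  have hlink : ∀ v ∈ Icc 1 n, ∀ P : ℕ → Prop,
      (∀ c d, c ≠ d → {v, c, d} ∈ facesOf Δ 3 → (P c ↔ P d)) →
      ∀ a b, {v, a} ∈ facesOf Δ 2 → {v, b} ∈ facesOf Δ 2 → (P a ↔ P b) := by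
    intro v hv P hP a b ha hb
    have key : ∀ a, {v, a} ∈ facesOf Δ 2 → {a} ∈ link Δ {v} := by
      intro a ha
      have hne : a ≠ v := by
        rintro rfl
        simpa using hE _ ha
      refine mem_link.mpr ⟨hΔ.1 _ (mem_filter.mp ha).1 _ (by simp), by simpa using hne, ?_⟩
      rw [union_singleton]
      exact (mem_filter.mp ha).1
    refine cutConnected_link hΔ hd hB (hΔ.2.2 v hv) P (fun c d hcd h => hP c d hcd ?_) a b
      (key a ha) (key b hb)
    rw [mem_link, union_singleton] at h
    refine mem_filter.mpr ⟨h.2.2, ?_⟩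
    rw [card_insert_of_notMem (by simpa using h.2.1), card_pair hcd]
  obtain ⟨κ, a, M, D, hI⟩ := exists_growthInvariant hE (hV 2) hT hT3 hcov hlink
  have hlow := two_mul_card_edges_le hE (hV 2) hT hT3 (hV 3) hlink
  obtain ⟨-, -, -, h4, h5, h6, h7, -, -, h0⟩ := hI
  have hin : ∀ m, inCount (facesOf Δ m) (Icc 1 n) = (facesOf Δ m).card := fun m => by
    rw [inCount, filter_true_of_mem (hV m)]
  simp only [hin, Nat.card_Icc, Nat.add_sub_cancel] at h4 h5 h7 hlow
  have hκ : κ ≠ 0 := by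
    intro hκ
    have hΔne : (∅ : Finset ℕ) ∈ Δ ∨ Δ = ∅ := by
      rcases Δ.eq_empty_or_nonempty with h | ⟨F, hF⟩
      · exact Or.inr h
      · exact Or.inl (hΔ.1 F hF _ (empty_subset _))
    rcases hΔne with h | h
    · obtain ⟨G, hG, -, hc⟩ := exists_superset_card_three hd hB.1 h
      obtain ⟨x, hx⟩ := card_pos.mp (hc ▸ (by norm_num : 0 < 3))
      have := hΔ.2.1 G hG x hx
      rw [h0 hκ] at this
      simp at this
    · simp [h, dimZ] at hd
  obtain ⟨k, rfl⟩ := Nat.exists_eq_succ_of_ne_zero hκ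
  exact ⟨k, a, M, h4, h5, h6, h7, hlow⟩

end Necessity

section Triangles

variable {n e t s : ℕ} {T : Finset (Finset ℕ)} {A : ℕ → ℕ → Prop}

/-- `a` and `b` are distinct vertices of a common member of `T`. -/
def EdgeRel (T : Finset (Finset ℕ)) (a b : ℕ) : Prop := a ≠ b ∧ ∃ F ∈ T, a ∈ F ∧ b ∈ F

/-- The two-element subsets of the members of `T`. -/
def edgesOf (T : Finset (Finset ℕ)) : Finset (Finset ℕ) := T.biUnion (powersetCard 2)

/-- `T` is the set of triangles of a pure `2`-dimensional complex on `[n]` all of whose vertex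
links are connected. -/
def IsTriangleSet (n : ℕ) (T : Finset (Finset ℕ)) : Prop :=
  (∀ F ∈ T, F.card = 3) ∧ (∀ F ∈ T, F ⊆ Icc 1 n) ∧ (∀ i ∈ Icc 1 n, ∃ F ∈ T, i ∈ F) ∧
    ∀ v, ∀ P : ℕ → Prop, (∀ c d, {v, c, d} ∈ T → (P c ↔ P d)) →
      ∀ a b, EdgeRel T v a → EdgeRel T v b → (P a ↔ P b)

/-- There is a connected triangle set on `[n]` with `e` edges, `t` triangles and adjacency
relation `A`. -/
def Realizable (n e t : ℕ) (A : ℕ → ℕ → Prop) : Prop :=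
  ∃ T, IsTriangleSet n T ∧
    (∀ P : ℕ → Prop, (∀ a b, A a b → (P a ↔ P b)) → ∀ a ∈ Icc 1 n, ∀ b ∈ Icc 1 n, (P a ↔ P b)) ∧
    (∀ a b, EdgeRel T a b ↔ A a b) ∧ (edgesOf T).card = e ∧ T.card = t

/-- `{a, b} = {x, y}` as unordered pairs. -/
def SamePair (a b x y : ℕ) : Prop := a = x ∧ b = y ∨ a = y ∧ b = x

lemma EdgeRel.symm {a b : ℕ} (h : EdgeRel T a b) : EdgeRel T b a := by
  obtain ⟨h, F, hF, ha, hb⟩ := h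
  exact ⟨h.symm, F, hF, hb, ha⟩

lemma edgeRel_insert {F : Finset ℕ} {a b : ℕ} :
    EdgeRel (insert F T) a b ↔ EdgeRel T a b ∨ a ≠ b ∧ a ∈ F ∧ b ∈ F := by
  simp only [EdgeRel, mem_insert]
  grind

lemma edgeRel_insert_triple {u v w a b : ℕ} (huv : u ≠ v) (huw : u ≠ w) (hvw : v ≠ w) :
    EdgeRel (insert {u, v, w} T) a b ↔
      EdgeRel T a b ∨ SamePair a b u v ∨ SamePair a b u w ∨ SamePair a b v w := by
  simp only [edgeRel_insert, mem_insert, mem_singleton, SamePair]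
  grind

lemma pair_mem_edgesOf {a b : ℕ} (h : a ≠ b) : {a, b} ∈ edgesOf T ↔ EdgeRel T a b := by
  simp only [edgesOf, mem_biUnion, mem_powersetCard, card_pair h, and_true, EdgeRel,
    insert_subset_iff, singleton_subset_iff]
  tauto

lemma mem_edgesOf {G : Finset ℕ} : G ∈ edgesOf T ↔ G.card = 2 ∧ ∃ F ∈ T, G ⊆ F := by
  simp only [edgesOf, mem_biUnion, mem_powersetCard]
  tauto

lemma pair_eq_pair {a b c d : ℕ} (hab : a ≠ b) :
    ({a, b} : Finset ℕ) = {c, d} ↔ SamePair a b c d := by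
  constructor
  · intro h
    have h1 : a ∈ ({c, d} : Finset ℕ) := h ▸ by simp
    have h2 : b ∈ ({c, d} : Finset ℕ) := h ▸ by simp
    simp only [mem_insert, mem_singleton] at h1 h2
    simp only [SamePair]
    omega
  · rintro (⟨rfl, rfl⟩ | ⟨rfl, rfl⟩)
    · rfl
    · exact pair_comm _ _

lemma edgesOf_insert {u v w : ℕ} (huv : u ≠ v) (huw : u ≠ w) (hvw : v ≠ w) :
    edgesOf (insert {u, v, w} T) =
      insert {u, v} (insert {u, w} (insert {v, w} (edgesOf T))) := by
  ext G
  by_cases hG : G.card = 2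
  · obtain ⟨a, b, hab, rfl⟩ := card_eq_two.mp hG
    simp only [mem_insert, pair_mem_edgesOf hab, edgeRel_insert_triple huv huw hvw,
      pair_eq_pair hab]
    tauto
  · have h2 : ∀ a b : ℕ, a ≠ b → G ≠ {a, b} := by
      rintro a b hab rfl
      exact hG (card_pair hab)
    simp [mem_edgesOf, hG, h2, huv, huw, hvw]

lemma card_triple {u v w : ℕ} (huv : u ≠ v) (huw : u ≠ w) (hvw : v ≠ w) :
    ({u, v, w} : Finset ℕ).card = 3 := card_eq_three.mpr ⟨u, v, w, huv, huw, hvw, rfl⟩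

lemma triple_rotate (a b c : ℕ) : ({a, b, c} : Finset ℕ) = {b, c, a} := by
  ext x
  simp only [mem_insert, mem_singleton]
  tauto

lemma Realizable.symm (h : Realizable n e t A) {a b : ℕ} (hab : A a b) : A b a := by
  obtain ⟨T, -, -, hA, -⟩ := h
  rw [← hA] at hab ⊢
  exact hab.symm

lemma Realizable.ne (h : Realizable n e t A) {a b : ℕ} (hab : A a b) : a ≠ b := by
  obtain ⟨T, -, -, hA, -⟩ := h
  rw [← hA] at hab
  exact hab.1

lemma Realizable.le (h : Realizable n e t A) {a b : ℕ} (hab : A a b) : 1 ≤ a ∧ a ≤ n := by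
  obtain ⟨T, hT, -, hA, -⟩ := h
  rw [← hA] at hab
  obtain ⟨-, F, hF, ha, -⟩ := hab
  simpa using hT.2.1 F hF ha

lemma Realizable.congr (h : Realizable n e t A) {A' : ℕ → ℕ → Prop}
    (hA : ∀ a b, A a b ↔ A' a b) : Realizable n e t A' := by
  obtain rfl : A = A' := by
    ext a b
    exact hA a b
  exact h

lemma realizable_triangle :
    Realizable 3 3 1 fun a b => a ≠ b ∧ 1 ≤ a ∧ a ≤ 3 ∧ 1 ≤ b ∧ b ≤ 3 := by
  have hJ : ∀ a b, EdgeRel {{1, 2, 3}} a b ↔ a ≠ b ∧ 1 ≤ a ∧ a ≤ 3 ∧ 1 ≤ b ∧ b ≤ 3 := by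
    intro a b
    simp only [EdgeRel, mem_singleton, exists_eq_left, mem_insert]
    omega
  refine ⟨{{1, 2, 3}}, ⟨?_, ?_, ?_, ?_⟩, ?_, hJ, ?_, rfl⟩
  · simp
  · intro F hF
    obtain rfl := mem_singleton.mp hF
    decide
  · intro i hi
    refine ⟨_, mem_singleton_self _, ?_⟩
    simp only [mem_Icc, mem_insert, mem_singleton] at hi ⊢
    omega
  · intro v P hP a b ha hb
    rw [hJ] at ha hb
    by_cases hab : a = b
    · rw [hab]
    refine hP a b (mem_singleton.mpr ?_)
    ext x
    simp only [mem_insert, mem_singleton]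
    omega
  · intro P hP a ha b hb
    simp only [mem_Icc] at ha hb
    by_cases hab : a = b
    · rw [hab]
    · exact hP a b ⟨hab, ha.1, ha.2, hb.1, hb.2⟩
  · simp [edgesOf, card_powersetCard]

lemma Realizable.addVertex (h : Realizable n e t A) {x y : ℕ} (hxy : A x y) :
    Realizable (n + 1) (e + 2) (t + 1)
      fun a b => A a b ∨ SamePair a b (n + 1) x ∨ SamePair a b (n + 1) y := by
  have hx := h.le hxy
  have hy := h.le (h.symm hxy)
  have hne := h.ne hxy
  obtain ⟨T, ⟨h3, hsub, hcov, hl⟩, hc, hA, rfl, rfl⟩ := h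
  have h1 : n + 1 ≠ x := by omega
  have h2 : n + 1 ≠ y := by omega
  have hnew : ∀ F ∈ T, n + 1 ∉ F := fun F hF hn => by simpa using hsub F hF hn
  have hnj : ∀ a, ¬ EdgeRel T (n + 1) a := fun a ha => by
    obtain ⟨-, F, hF, hn, -⟩ := ha
    exact hnew F hF hn
  have hJ : ∀ a b, EdgeRel (insert {n + 1, x, y} T) a b ↔
      A a b ∨ SamePair a b (n + 1) x ∨ SamePair a b (n + 1) y := by
    intro a b
    rw [edgeRel_insert_triple h1 h2 hne, hA]
    constructor
    · rintro (h | h | h | (⟨rfl, rfl⟩ | ⟨rfl, rfl⟩))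
      · exact Or.inl h
      · exact Or.inr (Or.inl h)
      · exact Or.inr (Or.inr h)
      · exact Or.inl hxy
      · exact Or.inl ((hA _ _).mp ((hA _ _).mpr hxy).symm)
    · tauto
  refine ⟨insert {n + 1, x, y} T, ⟨?_, ?_, ?_, ?_⟩, ?_, hJ, ?_, ?_⟩
  · intro F hF
    rcases mem_insert.mp hF with rfl | hF
    · exact card_triple h1 h2 hne
    · exact h3 F hF
  · intro F hF
    rcases mem_insert.mp hF with rfl | hF
    · intro a ha
      simp only [mem_insert, mem_singleton, mem_Icc] at ha ⊢
      omega
    · exact (hsub F hF).trans (Icc_subset_Icc_right (by omega))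
  · intro i hi
    by_cases hin : i = n + 1
    · exact ⟨_, mem_insert_self _ _, by simp [hin]⟩
    · simp only [mem_Icc] at hi
      obtain ⟨F, hF, hiF⟩ := hcov i (by simp; omega)
      exact ⟨F, mem_insert_of_mem hF, hiF⟩
  · intro v P hP
    have hold := hl v P fun c d hcd => hP c d (mem_insert_of_mem hcd)
    have hxy' : EdgeRel T x y := (hA _ _).mpr hxy
    have e1 : v = n + 1 → (P x ↔ P y) := by
      rintro rfl
      exact hP x y (mem_insert_self _ _)
    have e2 : v = x → (P (n + 1) ↔ P y) := by
      rintro rfl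
      exact hP _ _ (by rw [insert_comm]; exact mem_insert_self _ _)
    have e3 : v = y → (P (n + 1) ↔ P x) := by
      rintro rfl
      refine hP _ _ ?_
      rw [show ({v, n + 1, x} : Finset ℕ) = {n + 1, x, v} from triple_rotate _ _ _]
      exact mem_insert_self _ _
    have hyx' := hxy'.symm
    intro a b ha hb
    rw [edgeRel_insert_triple h1 h2 hne] at ha hb
    simp only [SamePair] at ha hb
    grind
  · intro P hP
    have hold := hc P fun a b hab => hP a b (Or.inl hab)
    have hnx := hP (n + 1) x (Or.inr (Or.inl (Or.inl ⟨rfl, rfl⟩)))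
    have hx' : x ∈ Icc 1 n := mem_Icc.mpr hx
    intro a ha b hb
    have hcase : ∀ a ∈ Icc 1 (n + 1), a = n + 1 ∨ a ∈ Icc 1 n := by
      intro a ha
      simp only [mem_Icc] at ha ⊢
      omega
    rcases hcase a ha with rfl | ha <;> rcases hcase b hb with rfl | hb
    · rfl
    · exact hnx.trans (hold x hx' b hb)
    · exact (hold a ha x hx').trans hnx.symm
    · exact hold a ha b hb
  · rw [edgesOf_insert h1 h2 hne, insert_eq_of_mem ((pair_mem_edgesOf hne).mpr ((hA _ _).mpr hxy)),
      card_insert_of_notMem, card_insert_of_notMem]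
    · rw [pair_mem_edgesOf h2]
      exact hnj _
    · rw [mem_insert, pair_mem_edgesOf h1, pair_eq_pair h1, SamePair]
      rintro (h | h)
      · omega
      · exact hnj _ h
  · rw [card_insert_of_notMem]
    exact fun h => hnew _ h (by simp)

lemma Realizable.addEdge (h : Realizable n e t A) {u v w : ℕ} (huw : A u w) (hwv : A w v)
    (huv' : u ≠ v) (huv : ¬ A u v) :
    Realizable n (e + 1) (t + 1) fun a b => A a b ∨ SamePair a b u v := by
  have hu := h.le huw
  have hw := h.le hwv
  have hv := h.le (h.symm hwv)
  have huw' := h.ne huw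
  have hwv' := h.ne hwv
  obtain ⟨T, ⟨h3, hsub, hcov, hl⟩, hc, hA, rfl, rfl⟩ := h
  have j1 := (hA _ _).mpr huw
  have j2 := (hA _ _).mpr hwv
  have j1' := j1.symm
  have j2' := j2.symm
  have j3 : ¬ EdgeRel T u v := by rwa [hA]
  have hJ : ∀ a b, EdgeRel (insert {u, v, w} T) a b ↔ A a b ∨ SamePair a b u v := by
    intro a b
    rw [edgeRel_insert_triple huv' huw' hwv'.symm]
    simp only [SamePair, ← hA]
    grind
  refine ⟨insert {u, v, w} T, ⟨?_, ?_, ?_, ?_⟩, ?_, hJ, ?_, ?_⟩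
  · intro F hF
    rcases mem_insert.mp hF with rfl | hF
    · exact card_triple huv' huw' hwv'.symm
    · exact h3 F hF
  · intro F hF
    rcases mem_insert.mp hF with rfl | hF
    · intro a ha
      simp only [mem_insert, mem_singleton, mem_Icc] at ha ⊢
      omega
    · exact hsub F hF
  · intro i hi
    obtain ⟨F, hF, hiF⟩ := hcov i hi
    exact ⟨F, mem_insert_of_mem hF, hiF⟩
  · intro p P hP
    have hold := hl p P fun c d hcd => hP c d (mem_insert_of_mem hcd)
    have e1 : p = u → (P v ↔ P w) := by
      rintro rfl
      exact hP _ _ (mem_insert_self _ _)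
    have e2 : p = v → (P u ↔ P w) := by
      rintro rfl
      exact hP _ _ (by rw [insert_comm]; exact mem_insert_self _ _)
    intro a b ha hb
    rw [edgeRel_insert_triple huv' huw' hwv'.symm] at ha hb
    simp only [SamePair] at ha hb
    grind
  · exact fun P hP => hc P fun a b hab => hP a b (Or.inl hab)
  · rw [edgesOf_insert huv' huw' hwv'.symm,
      insert_eq_of_mem ((pair_mem_edgesOf hwv'.symm).mpr j2'),
      insert_eq_of_mem ((pair_mem_edgesOf huw').mpr j1), card_insert_of_notMem]
    rwa [pair_mem_edgesOf huv']
  · rw [card_insert_of_notMem]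
    exact fun h => j3 ⟨huv', _, h, by simp, by simp⟩

lemma Realizable.addPath (h : Realizable n e t A) {u v w x : ℕ} (hwv : A w v) (hux : A u x)
    (huv : ¬ A u v) (huw : ¬ A u w) (hvx : ¬ A v x) (huv' : u ≠ v) (huw' : u ≠ w) (hvx' : v ≠ x) :
    Realizable n (e + 3) (t + 2)
      fun a b => A a b ∨ SamePair a b u v ∨ SamePair a b u w ∨ SamePair a b v x := by
  have hu := h.le hux
  have hw := h.le hwv
  have hv := h.le (h.symm hwv)
  have hx := h.le (h.symm hux)
  have hwv' := h.ne hwv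
  have hux' := h.ne hux
  obtain ⟨T, ⟨h3, hsub, hcov, hl⟩, hc, hA, rfl, rfl⟩ := h
  have j1 := (hA _ _).mpr hwv
  have j2 := (hA _ _).mpr hux
  have j1' := j1.symm
  have j2' := j2.symm
  have k1 : ¬ EdgeRel T u v := by rwa [hA]
  have k2 : ¬ EdgeRel T u w := by rwa [hA]
  have k3 : ¬ EdgeRel T v x := by rwa [hA]
  have hJ' : ∀ a b, EdgeRel (insert {u, v, x} (insert {u, v, w} T)) a b ↔
      EdgeRel T a b ∨ SamePair a b u v ∨ SamePair a b u w ∨ SamePair a b v x := by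
    intro a b
    rw [edgeRel_insert_triple huv' hux' hvx', edgeRel_insert_triple huv' huw' hwv'.symm]
    simp only [SamePair]
    grind
  have hxw : x ≠ w := by
    rintro rfl
    exact k2 j2
  have hnew : ({u, v, w} : Finset ℕ) ∉ T :=
    fun h => k1 ⟨huv', _, h, by simp, by simp⟩
  refine ⟨insert {u, v, x} (insert {u, v, w} T), ⟨?_, ?_, ?_, ?_⟩, ?_,
    by simpa only [hA] using hJ', ?_, ?_⟩
  · intro F hF
    simp only [mem_insert] at hF
    rcases hF with rfl | rfl | hF
    · exact card_triple huv' hux' hvx'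
    · exact card_triple huv' huw' hwv'.symm
    · exact h3 F hF
  · intro F hF
    simp only [mem_insert] at hF
    rcases hF with rfl | rfl | hF
    · intro a ha
      simp only [mem_insert, mem_singleton, mem_Icc] at ha ⊢
      omega
    · intro a ha
      simp only [mem_insert, mem_singleton, mem_Icc] at ha ⊢
      omega
    · exact hsub F hF
  · intro i hi
    obtain ⟨F, hF, hiF⟩ := hcov i hi
    exact ⟨F, mem_insert_of_mem (mem_insert_of_mem hF), hiF⟩
  · intro p P hP
    have hold := hl p P fun c d hcd => hP c d (mem_insert_of_mem (mem_insert_of_mem hcd))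
    have e1 : p = u → (P v ↔ P w) := by
      rintro rfl
      exact hP _ _ (mem_insert_of_mem (mem_insert_self _ _))
    have e2 : p = v → (P u ↔ P w) := by
      rintro rfl
      exact hP _ _ (by rw [insert_comm p u]; exact mem_insert_of_mem (mem_insert_self _ _))
    have e3 : p = u → (P v ↔ P x) := by
      rintro rfl
      exact hP _ _ (mem_insert_self _ _)
    have e4 : p = v → (P u ↔ P x) := by
      rintro rfl
      exact hP _ _ (by rw [insert_comm p u]; exact mem_insert_self _ _)
    have e5 : p = w → (P u ↔ P v) := by
      rintro rfl
      refine hP _ _ (mem_insert_of_mem ?_)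
      rw [show ({p, u, v} : Finset ℕ) = {u, v, p} from triple_rotate _ _ _]
      exact mem_insert_self _ _
    have e6 : p = x → (P u ↔ P v) := by
      rintro rfl
      refine hP _ _ ?_
      rw [show ({p, u, v} : Finset ℕ) = {u, v, p} from triple_rotate _ _ _]
      exact mem_insert_self _ _
    intro a b ha hb
    rw [hJ'] at ha hb
    simp only [SamePair] at ha hb
    grind
  · exact fun P hP => hc P fun a b hab => hP a b (Or.inl hab)
  · rw [edgesOf_insert huv' hux' hvx', edgesOf_insert huv' huw' hwv'.symm]
    have hvw2 : {v, w} ∈ edgesOf T := (pair_mem_edgesOf hwv'.symm).mpr j1'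
    have hux2 : {u, x} ∈ edgesOf T := (pair_mem_edgesOf hux').mpr j2
    have hset : insert {u, v} (insert {u, x} (insert {v, x} (insert {u, v} (insert {u, w}
        (edgesOf T))))) = insert {v, x} (insert {u, v} (insert {u, w} (edgesOf T))) := by
      ext G
      by_cases hG : G = {u, x}
      · subst hG
        simp [hux2]
      · simp only [mem_insert]
        tauto
    rw [insert_eq_of_mem hvw2, hset, card_insert_of_notMem, card_insert_of_notMem,
      card_insert_of_notMem]
    · rwa [pair_mem_edgesOf huw']
    · rw [mem_insert, pair_mem_edgesOf huv', pair_eq_pair huv', SamePair]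
      rintro (h | h)
      · omega
      · exact k1 h
    · rw [mem_insert, mem_insert, pair_mem_edgesOf hvx', pair_eq_pair hvx', pair_eq_pair hvx',
        SamePair, SamePair]
      rintro (h | h | h)
      · omega
      · omega
      · exact k3 h
  · rw [card_insert_of_notMem, card_insert_of_notMem hnew]
    intro h
    rcases mem_insert.mp h with h | h
    · have : x ∈ ({u, v, w} : Finset ℕ) := h ▸ by simp
      simp only [mem_insert, mem_singleton] at this
      omega
    · exact k1 ⟨huv', _, h, by simp, by simp⟩

lemma Realizable.fill (h : Realizable n e t A) (hts : t ≤ s) {C : Finset (Finset ℕ)}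
    (hC : ∀ F ∈ C, F.card = 3 ∧ ∀ a ∈ F, ∀ b ∈ F, a ≠ b → A a b) (hs : s ≤ C.card) :
    Realizable n e s A := by
  obtain ⟨T, ⟨h3, hsub, hcov, hl⟩, hc, hA, rfl, rfl⟩ := h
  obtain ⟨T', hTT', hT', rfl⟩ := exists_subsuperset_card_eq (subset_union_left (s₁ := T) (s₂ := C))
    hts (hs.trans (card_le_card subset_union_right))
  have hJ : ∀ a b, EdgeRel T' a b ↔ EdgeRel T a b := by
    intro a b
    constructor
    · rintro ⟨hab, F, hF, ha, hb⟩
      rcases mem_union.mp (hT' hF) with hF | hF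
      · exact ⟨hab, F, hF, ha, hb⟩
      · exact (hA a b).mpr ((hC F hF).2 a ha b hb hab)
    · rintro ⟨hab, F, hF, ha, hb⟩
      exact ⟨hab, F, hTT' hF, ha, hb⟩
  refine ⟨T', ⟨?_, ?_, ?_, ?_⟩, hc, ?_, ?_, rfl⟩
  · intro F hF
    rcases mem_union.mp (hT' hF) with hF | hF
    · exact h3 F hF
    · exact (hC F hF).1
  · intro F hF
    rcases mem_union.mp (hT' hF) with hF | hF
    · exact hsub F hF
    · intro a ha
      obtain ⟨b, hb, hne⟩ := exists_mem_ne (by have := (hC F hF).1; omega : 1 < F.card) a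
      obtain ⟨-, G, hG, haG, -⟩ := (hA a b).mpr ((hC F hF).2 a ha b hb hne.symm)
      exact hsub G hG haG
  · intro i hi
    obtain ⟨F, hF, hiF⟩ := hcov i hi
    exact ⟨F, hTT' hF, hiF⟩
  · intro v P hP a b ha hb
    rw [hJ] at ha hb
    exact hl v P (fun c d hcd => hP c d (hTT' hcd)) a b ha hb
  · intro a b
    rw [hJ, hA]
  · congr 1
    ext G
    by_cases hG : G.card = 2
    · obtain ⟨a, b, hab, rfl⟩ := card_eq_two.mp hG
      rw [pair_mem_edgesOf hab, pair_mem_edgesOf hab, hJ]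
    · simp [mem_edgesOf, hG]

end Triangles

section TriangleComplex

variable {n : ℕ} {T : Finset (Finset ℕ)}

lemma IsTriangleSet.disjointTriangle (h : IsTriangleSet n T) :
    ∃ T', IsTriangleSet (n + 3) T' ∧ (edgesOf T').card = (edgesOf T).card + 3 ∧
      T'.card = T.card + 1 := by
  obtain ⟨h3, hsub, hcov, hl⟩ := h
  have d1 : n + 1 ≠ n + 2 := by omega
  have d2 : n + 1 ≠ n + 3 := by omega
  have d3 : n + 2 ≠ n + 3 := by omega
  have hnew : ∀ F ∈ T, ∀ a ∈ F, a ≤ n := fun F hF a ha => (mem_Icc.mp (hsub F hF ha)).2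
  have hnj : ∀ a b, EdgeRel T a b → a ≤ n ∧ b ≤ n := fun a b ⟨_, F, hF, ha, hb⟩ =>
    ⟨hnew F hF a ha, hnew F hF b hb⟩
  refine ⟨insert {n + 1, n + 2, n + 3} T, ⟨?_, ?_, ?_, ?_⟩, ?_, ?_⟩
  · intro F hF
    rcases mem_insert.mp hF with rfl | hF
    · exact card_triple d1 d2 d3
    · exact h3 F hF
  · intro F hF
    rcases mem_insert.mp hF with rfl | hF
    · intro a ha
      simp only [mem_insert, mem_singleton, mem_Icc] at ha ⊢
      omega
    · exact (hsub F hF).trans (Icc_subset_Icc_right (by omega))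
  · intro i hi
    by_cases hin : n < i
    · refine ⟨_, mem_insert_self _ _, ?_⟩
      simp only [mem_insert, mem_singleton, mem_Icc] at hi ⊢
      omega
    · simp only [mem_Icc] at hi
      obtain ⟨F, hF, hiF⟩ := hcov i (by simp; omega)
      exact ⟨F, mem_insert_of_mem hF, hiF⟩
  · intro v P hP a b ha hb
    by_cases hv : v ≤ n
    · refine hl v P (fun c d hcd => hP c d (mem_insert_of_mem hcd)) a b ?_ ?_
      · refine (edgeRel_insert.mp ha).resolve_right fun h => ?_
        have := h.2.1
        simp only [mem_insert, mem_singleton] at this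
        omega
      · refine (edgeRel_insert.mp hb).resolve_right fun h => ?_
        have := h.2.1
        simp only [mem_insert, mem_singleton] at this
        omega
    · have ha' := (edgeRel_insert.mp ha).resolve_left fun h => hv (hnj _ _ h).1
      have hb' := (edgeRel_insert.mp hb).resolve_left fun h => hv (hnj _ _ h).1
      by_cases hab : a = b
      · rw [hab]
      refine hP a b (mem_insert.mpr (Or.inl ?_))
      ext x
      simp only [mem_insert, mem_singleton] at ha' hb' ⊢
      omega
  · rw [edgesOf_insert d1 d2 d3, card_insert_of_notMem, card_insert_of_notMem,
      card_insert_of_notMem]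
    · rw [pair_mem_edgesOf d3]
      intro h
      have := hnj _ _ h
      omega
    · rw [mem_insert, pair_mem_edgesOf d2, pair_eq_pair d2, SamePair]
      rintro (h | h)
      · omega
      · have := hnj _ _ h
        omega
    · rw [mem_insert, mem_insert, pair_mem_edgesOf d1, pair_eq_pair d1, pair_eq_pair d1, SamePair,
        SamePair]
      rintro (h | h | h)
      · omega
      · omega
      · have := hnj _ _ h
        omega
  · rw [card_insert_of_notMem]
    intro h
    have := hnew _ h (n + 1) (by simp)
    omega

lemma IsTriangleSet.disjointTriangles (h : IsTriangleSet n T) (k : ℕ) :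
    ∃ T', IsTriangleSet (n + 3 * k) T' ∧ (edgesOf T').card = (edgesOf T).card + 3 * k ∧
      T'.card = T.card + k := by
  induction k with
  | zero => exact ⟨T, h, rfl, rfl⟩
  | succ k ih =>
    obtain ⟨T', h', h2, h3⟩ := ih
    obtain ⟨T'', h'', h2', h3'⟩ := h'.disjointTriangle
    exact ⟨T'', h'', by omega, by omega⟩

lemma IsTriangleSet.exists_isBuchsbaum (K : Type) [Field K] (h : IsTriangleSet n T)
    (hn : 1 ≤ n) : ∃ Δ, IsComplexOn n Δ ∧ dimZ Δ = 2 ∧ IsBuchsbaum K Δ ∧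
      (facesOf Δ 2).card = (edgesOf T).card ∧ (facesOf Δ 3).card = T.card := by
  obtain ⟨h3, hsub, hcov, hl⟩ := h
  have hmem : ∀ F, F ∈ T.biUnion powerset ↔ ∃ G ∈ T, F ⊆ G := by simp
  obtain ⟨F₀, hF₀, -⟩ := hcov 1 (by simp [hn])
  have hdown : ∀ F ∈ T.biUnion powerset, ∀ G ⊆ F, G ∈ T.biUnion powerset := by
    intro F hF G hGF
    rw [hmem] at hF ⊢
    obtain ⟨H, hH, hFH⟩ := hF
    exact ⟨H, hH, hGF.trans hFH⟩
  have hle : ∀ F ∈ T.biUnion powerset, F.card ≤ 3 := by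
    intro F hF
    obtain ⟨G, hG, hFG⟩ := (hmem F).mp hF
    exact h3 G hG ▸ card_le_card hFG
  have hT : ∀ F, F ∈ T ↔ F ∈ T.biUnion powerset ∧ F.card = 3 := by
    intro F
    constructor
    · exact fun hF => ⟨(hmem F).mpr ⟨F, hF, Subset.rfl⟩, h3 F hF⟩
    · rintro ⟨hF, hc⟩
      obtain ⟨G, hG, hFG⟩ := (hmem F).mp hF
      rwa [eq_of_subset_of_card_le hFG (by rw [h3 G hG, hc])]
  have hdim : (T.biUnion powerset).sup Finset.card = 3 :=
    dimZ_eq ((hT F₀).mp hF₀).1 (h3 F₀ hF₀) hle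
  refine ⟨T.biUnion powerset, ⟨hdown, ?_, ?_⟩, by simp [dimZ, hdim], ⟨?_, ?_⟩, ?_, ?_⟩
  · intro F hF i hi
    obtain ⟨G, hG, hFG⟩ := (hmem F).mp hF
    exact hsub G hG (hFG hi)
  · intro i hi
    obtain ⟨F, hF, hiF⟩ := hcov i hi
    exact (hmem _).mpr ⟨F, hF, by simpa using hiF⟩
  · intro F hF hmax
    obtain ⟨G, hG, hFG⟩ := (hmem F).mp hF
    rw [hmax G ((hT G).mp hG).1 hFG, h3 G hG, hdim]
  · intro v hv
    have hlk : ∀ G, G ∈ link (T.biUnion powerset) {v} ↔ v ∉ G ∧ ∃ H ∈ T, insert v G ⊆ H := by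
      intro G
      rw [mem_link, union_singleton, hmem, hmem, disjoint_singleton_right]
      constructor
      · exact fun h => h.2
      · rintro ⟨h1, H, hH, hGH⟩
        exact ⟨⟨H, hH, (subset_insert _ _).trans hGH⟩, h1, H, hH, hGH⟩
    refine isCohenMacaulay_of_cutConnected K ?_ ?_ ?_ ?_
    · intro F hF G hGF
      rw [hlk] at hF ⊢
      obtain ⟨h1, H, hH, hFH⟩ := hF
      exact ⟨fun h => h1 (hGF h), H, hH, (insert_subset_insert _ hGF).trans hFH⟩
    · intro F hF
      rw [hlk] at hF
      obtain ⟨h1, H, hH, hFH⟩ := hF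
      have hvH : v ∈ H := hFH (mem_insert_self _ _)
      refine ⟨H.erase v, (hlk _).mpr ⟨by simp, H, hH, (insert_erase hvH).subset⟩,
        fun x hx => mem_erase.mpr ⟨fun hxv => h1 (hxv ▸ hx), hFH (mem_insert_of_mem hx)⟩, ?_⟩
      rw [card_erase_of_mem hvH, h3 H hH]
    · intro F hF
      rw [hlk] at hF
      obtain ⟨h1, H, hH, hFH⟩ := hF
      have := card_le_card hFH
      rw [card_insert_of_notMem h1, h3 H hH] at this
      omega
    · intro P hP a b ha hb
      have key : ∀ a, {a} ∈ link (T.biUnion powerset) {v} → EdgeRel T v a := by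
        intro a ha
        rw [hlk] at ha
        obtain ⟨h1, H, hH, hFH⟩ := ha
        exact ⟨by simpa using h1, H, hH, hFH (by simp), hFH (by simp)⟩
      refine hl v P (fun c d hcd => ?_) a b (key a ha) (key b hb)
      have hcard := h3 _ hcd
      have hv : v ∉ ({c, d} : Finset ℕ) := by
        intro hv
        rw [insert_eq_of_mem hv] at hcard
        have := card_le_two (a := c) (b := d)
        omega
      by_cases hcd' : c = d
      · rw [hcd']
      · exact hP c d hcd' ((hlk _).mpr ⟨hv, _, hcd, Subset.rfl⟩)
  · congr 1
    ext F
    rw [mem_edgesOf, facesOf, mem_filter, hmem]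
    tauto
  · congr 1
    ext F
    rw [facesOf, mem_filter, hT]

end TriangleComplex

section Extremal

variable {n e t s M : ℕ} {A : ℕ → ℕ → Prop}

lemma Realizable.exists_adj (h : Realizable n e t A) (hn : 1 ≤ n) : ∃ x y, A x y := by
  obtain ⟨T, ⟨h3, -, hcov, -⟩, -, hA, -⟩ := h
  obtain ⟨F, hF, h1⟩ := hcov 1 (by simp [hn])
  obtain ⟨b, hb, hne⟩ := exists_mem_ne (by have := h3 F hF; omega : 1 < F.card) 1
  exact ⟨1, b, (hA _ _).mp ⟨hne.symm, F, hF, h1, hb⟩⟩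

lemma Realizable.choose_two_le (h : Realizable n e t A) {x y : ℕ}
    (hc : ∀ a ∈ Icc 1 n, ∀ b ∈ Icc 1 n, a ≠ b → ¬ SamePair a b x y → A a b) :
    n.choose 2 ≤ e + 1 := by
  obtain ⟨T, -, -, hA, rfl, -⟩ := h
  refine le_trans ?_ (card_insert_le {x, y} (edgesOf T))
  conv_lhs => rw [← Nat.add_sub_cancel (n := n) (m := 1), ← Nat.card_Icc, ← card_powersetCard]
  refine card_le_card fun F hF => ?_
  obtain ⟨hF, hc2⟩ := mem_powersetCard.mp hF
  obtain ⟨a, b, hab, rfl⟩ := card_eq_two.mp hc2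
  rw [mem_insert, pair_eq_pair hab, pair_mem_edgesOf hab, hA]
  by_cases hp : SamePair a b x y
  · exact Or.inl hp
  · exact Or.inr (hc a (hF (by simp)) b (hF (by simp)) hab hp)

lemma Realizable.choose_two_le_of_complete (h : Realizable n e t A)
    (hc : ∀ a ∈ Icc 1 n, ∀ b ∈ Icc 1 n, a ≠ b → A a b) : n.choose 2 ≤ e := by
  obtain ⟨T, -, -, hA, rfl, -⟩ := h
  conv_lhs => rw [← Nat.add_sub_cancel (n := n) (m := 1), ← Nat.card_Icc, ← card_powersetCard]
  refine card_le_card fun F hF => ?_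
  obtain ⟨hF, hc2⟩ := mem_powersetCard.mp hF
  obtain ⟨a, b, hab, rfl⟩ := card_eq_two.mp hc2
  rw [pair_mem_edgesOf hab, hA]
  exact hc a (hF (by simp)) b (hF (by simp)) hab

lemma Realizable.exists_addEdge (h : Realizable n e t A) (he : e < n.choose 2) :
    ∃ A', Realizable n (e + 1) (t + 1) A' := by
  by_cases hex : ∃ u w v, A u w ∧ A w v ∧ u ≠ v ∧ ¬ A u v
  · obtain ⟨u, w, v, h1, h2, h3, h4⟩ := hex
    exact ⟨_, h.addEdge h1 h2 h3 h4⟩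
  refine absurd (h.choose_two_le_of_complete fun u hu b hb hub => ?_) he.not_ge
  have hP : ∀ a b, A a b → (u = a ∨ A u a) → (u = b ∨ A u b) := by
    rintro a b hab (rfl | hua)
    · exact Or.inr hab
    · by_cases hub : u = b
      · exact Or.inl hub
      · by_contra hcon
        exact hex ⟨u, a, b, hua, hab, hub, fun h => hcon (Or.inr h)⟩
  obtain ⟨T, -, hc, -⟩ := id h
  exact (((hc (fun b => u = b ∨ A u b) fun a b hab => ⟨hP a b hab, hP b a (h.symm hab)⟩)
    u hu b hb).mp (Or.inl rfl)).resolve_left hub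

lemma Realizable.exists_addEdges (h : Realizable n e t A) (i : ℕ) (he : e + i ≤ n.choose 2) :
    ∃ A', Realizable n (e + i) (t + i) A' := by
  induction i with
  | zero => exact ⟨A, h⟩
  | succ i ih =>
    obtain ⟨A', h'⟩ := ih (by omega)
    exact h'.exists_addEdge (by omega)

lemma Realizable.exists_addVertices (h : Realizable n e t A) (hn : 1 ≤ n) (i : ℕ) :
    ∃ A', Realizable (n + i) (e + 2 * i) (t + i) A' := by
  induction i with
  | zero => exact ⟨A, h⟩
  | succ i ih =>
    obtain ⟨A', h'⟩ := ih
    obtain ⟨x, y, hxy⟩ := h'.exists_adj (by omega)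
    exact ⟨_, h'.addVertex hxy⟩

/-- The complete graph on `1, …, m + 2` together with a vertex `m + 3` joined to `1, …, r + 2`. -/
def ColexAdj (m r a b : ℕ) : Prop :=
  a ≠ b ∧ 1 ≤ a ∧ 1 ≤ b ∧ a ≤ m + 3 ∧ b ≤ m + 3 ∧ (a ≤ m + 2 ∨ b ≤ r + 2) ∧
    (b ≤ m + 2 ∨ a ≤ r + 2)

lemma realizable_colexAdj {m r : ℕ} (hr : r ≤ m) :
    Realizable (m + 3) ((m + 2).choose 2 + r + 2) ((m + 1).choose 2 + r + 1) (ColexAdj m r) := by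
  have step : ∀ m r, r ≤ m →
      Realizable (m + 3) ((m + 2).choose 2 + 2) ((m + 1).choose 2 + 1) (ColexAdj m 0) →
      Realizable (m + 3) ((m + 2).choose 2 + r + 2) ((m + 1).choose 2 + r + 1) (ColexAdj m r) := by
    intro m r
    induction r with
    | zero => exact fun _ h => h
    | succ r ih =>
      intro hr h
      have := ih (by omega) h
      have h' := this.addEdge (u := m + 3) (v := r + 3) (w := 1) (by simp only [ColexAdj]; omega)
        (by simp only [ColexAdj]; omega) (by omega) (by simp only [ColexAdj]; omega)
      rw [show (m + 2).choose 2 + (r + 1) + 2 = (m + 2).choose 2 + r + 2 + 1 by ring,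
        show (m + 1).choose 2 + (r + 1) + 1 = (m + 1).choose 2 + r + 1 + 1 by ring]
      refine h'.congr fun a b => ?_
      simp only [ColexAdj, SamePair]
      omega
  refine step m r hr ?_
  clear hr
  induction m with
  | zero =>
    refine realizable_triangle.congr fun a b => ?_
    simp only [ColexAdj]
    omega
  | succ m ih =>
    have h := (step m m le_rfl ih).addVertex (x := 1) (y := 2) (by simp only [ColexAdj]; omega)
    have e1 := choose_two_succ (m + 2)
    have e2 := choose_two_succ (m + 1)
    rw [show (m + 1 + 2).choose 2 + 2 = (m + 2).choose 2 + m + 2 + 2 by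
        rw [show m + 1 + 2 = m + 2 + 1 by ring]; omega,
      show (m + 1 + 1).choose 2 + 1 = (m + 1).choose 2 + m + 1 + 1 by omega,
      show m + 1 + 3 = m + 3 + 1 by ring]
    refine h.congr fun a b => ?_
    simp only [ColexAdj, SamePair]
    omega

lemma exists_realizable_of_le_macaulay2 {a h : ℕ} (ha : a ≤ (M + 1).choose 2)
    (hh : h ≤ macaulay2 a) : ∃ A, Realizable (M + 3) (2 * M + 3 + a) (h + M + a + 1) A := by
  obtain ⟨b, r, hr, hbM, rfl⟩ : ∃ b r, r ≤ b ∧ b ≤ M ∧ a = b.choose 2 + r := by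
    obtain ⟨b, r, hr, rfl⟩ := exists_eq_choose_two_add a
    rcases Nat.lt_or_ge M b with hb | hb
    · have := Nat.choose_le_choose 2 (show M + 1 ≤ b from hb)
      have e := choose_two_succ M
      exact ⟨M, M, le_rfl, le_rfl, by omega⟩
    · exact ⟨b, r, hr.le, hb, rfl⟩
  rw [macaulay2_eq hr] at hh
  have e1 := choose_two_succ b
  have e2 := choose_two_succ (b + 1)
  have e3 : (b + 2).choose 3 = (b + 1).choose 2 + (b + 1).choose 3 := Nat.choose_succ_succ' _ _
  have e4 := choose_two_succ (r + 1)
  have hC : ((powersetCard 3 (Icc 1 (b + 2))) ∪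
      (powersetCard 2 (Icc 1 (r + 2))).image (insert (b + 3))).card =
      (b + 2).choose 3 + (r + 2).choose 2 := by
    have hni : ∀ F ∈ powersetCard 2 (Icc 1 (r + 2)), b + 3 ∉ F := by
      intro F hF hb
      have := mem_Icc.mp ((mem_powersetCard.mp hF).1 hb)
      omega
    rw [card_union_of_disjoint, card_image_of_injOn, card_powersetCard, card_powersetCard]
    · simp
    · intro F hF G hG h
      rw [← erase_insert (hni F hF), ← erase_insert (hni G hG)]
      exact congrArg (·.erase (b + 3)) h
    · rw [disjoint_left]
      intro F hF hF'
      obtain ⟨G, -, rfl⟩ := mem_image.mp hF'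
      have := mem_Icc.mp ((mem_powersetCard.mp hF).1 (mem_insert_self _ _))
      omega
  have hfill := (realizable_colexAdj hr).fill (s := h + b + (b.choose 2 + r) + 1) (by omega)
    (C := (powersetCard 3 (Icc 1 (b + 2))) ∪
      (powersetCard 2 (Icc 1 (r + 2))).image (insert (b + 3))) (by
      intro F hF
      rcases mem_union.mp hF with hF | hF
      · obtain ⟨hF, hc⟩ := mem_powersetCard.mp hF
        refine ⟨hc, fun x hx y hy hxy => ?_⟩
        have := mem_Icc.mp (hF hx)
        have := mem_Icc.mp (hF hy)
        simp only [ColexAdj]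
        omega
      · obtain ⟨G, hG, rfl⟩ := mem_image.mp hF
        obtain ⟨hG, hc⟩ := mem_powersetCard.mp hG
        have hbG : b + 3 ∉ G := by
          intro hb
          have := mem_Icc.mp (hG hb)
          omega
        refine ⟨by rw [card_insert_of_notMem hbG, hc], fun x hx y hy hxy => ?_⟩
        have key : ∀ x ∈ insert (b + 3) G, x = b + 3 ∨ 1 ≤ x ∧ x ≤ r + 2 := by
          intro x hx
          rcases mem_insert.mp hx with h | h
          · exact Or.inl h
          · exact Or.inr (mem_Icc.mp (hG h))
        have := key x hx
        have := key y hy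
        simp only [ColexAdj]
        omega) (by rw [hC]; simp only [add_assoc, Nat.reduceAdd] at *; omega)
  obtain ⟨A, hA⟩ := hfill.exists_addVertices (by omega) (M - b)
  refine ⟨A, ?_⟩
  convert hA using 1 <;> simp only [add_assoc, Nat.reduceAdd] at * <;> omega

/-- The adjacency relation `A` is realizable on `[M + 3]` with `3 q` edges more than a stacked
complex and with third `h`-number `-q`, and so are some adjacency relations for smaller `q`. -/
def Descending (M : ℕ) (A : ℕ → ℕ → Prop) : Prop :=
  ∃ q, Realizable (M + 3) (2 * M + 3 + 3 * q) (M + 1 + 2 * q) A ∧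
    ∀ q' < q, ∃ A', Realizable (M + 3) (2 * M + 3 + 3 * q') (M + 1 + 2 * q') A'

lemma Descending.congr (h : Descending M A) {A' : ℕ → ℕ → Prop}
    (hA : ∀ a b, A a b ↔ A' a b) : Descending M A' := by
  obtain ⟨q, h, h'⟩ := h
  exact ⟨q, h.congr hA, h'⟩

lemma Descending.addVertex (h : Descending M A) {x y : ℕ} (hxy : A x y) :
    Descending (M + 1) fun a b => A a b ∨ SamePair a b (M + 4) x ∨ SamePair a b (M + 4) y := by
  obtain ⟨q, h, h'⟩ := h
  have e1 : ∀ q, 2 * (M + 1) + 3 + 3 * q = 2 * M + 3 + 3 * q + 2 := fun q => by ring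
  have e2 : ∀ q, M + 1 + 1 + 2 * q = M + 1 + 2 * q + 1 := fun q => by ring
  refine ⟨q, ?_, fun q' hq' => ?_⟩
  · rw [e1, e2]
    exact h.addVertex hxy
  · obtain ⟨A', h''⟩ := h' q' hq'
    rw [e1, e2]
    exact h''.exists_addVertices (by omega) 1

lemma Descending.addPath (h : Descending M A) {u v w x : ℕ} (hwv : A w v) (hux : A u x)
    (huv : ¬ A u v) (huw : ¬ A u w) (hvx : ¬ A v x) (huv' : u ≠ v) (huw' : u ≠ w) (hvx' : v ≠ x) :
    Descending M
      fun a b => A a b ∨ SamePair a b u v ∨ SamePair a b u w ∨ SamePair a b v x := by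
  obtain ⟨q, h, h'⟩ := h
  refine ⟨q + 1, h.addPath hwv hux huv huw hvx huv' huw' hvx', fun q' hq' => ?_⟩
  rcases Nat.lt_succ_iff_lt_or_eq.mp hq' with hq' | rfl
  · exact h' q' hq'
  · exact ⟨A, h⟩

/-- The complete graph on `1, …, n` without the edge `{1, z}`. -/
def NearlyComplete (n z a b : ℕ) : Prop :=
  a ≠ b ∧ 1 ≤ a ∧ 1 ≤ b ∧ a ≤ n ∧ b ≤ n ∧ ¬ SamePair a b 1 z

/-- The graph on `1, …, n + 3` in which `1, …, n` span a complete graph without the edge `{1, z}`,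
and `n + 1, n + 2, n + 3` are joined to each other and to `1, …, i`. -/
def PartialJoin (n z i a b : ℕ) : Prop :=
  a ≠ b ∧ 1 ≤ a ∧ 1 ≤ b ∧ a ≤ n + 3 ∧ b ≤ n + 3 ∧ ¬ SamePair a b 1 z ∧
    (a ≤ n ∧ b ≤ n ∨ n < a ∧ n < b ∨ a ≤ i ∨ b ≤ i)

lemma Descending.partialJoin {z : ℕ} (i d : ℕ) (hi : 2 ≤ i) (hd : i + 2 * d = M + 3)
    (h : Descending (M + 3) (PartialJoin (M + 3) z i)) :
    Descending (M + 3) (PartialJoin (M + 3) z (M + 3)) := by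
  induction d generalizing i with
  | zero =>
    obtain rfl : i = M + 3 := by omega
    exact h
  | succ d ih =>
    refine ih (i + 2) (by omega) (by omega) ?_
    have h1 := h.addPath (u := M + 4) (v := i + 1) (w := i + 2) (x := M + 5)
      (by simp only [PartialJoin, SamePair]; omega) (by simp only [PartialJoin, SamePair]; omega)
      (by simp only [PartialJoin, SamePair]; omega) (by simp only [PartialJoin, SamePair]; omega)
      (by simp only [PartialJoin, SamePair]; omega) (by omega) (by omega) (by omega)
    have h2 := h1.addPath (u := M + 6) (v := i + 2) (w := i + 1) (x := M + 5)
      (by simp only [PartialJoin, SamePair]; omega) (by simp only [PartialJoin, SamePair]; omega)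
      (by simp only [PartialJoin, SamePair]; omega) (by simp only [PartialJoin, SamePair]; omega)
      (by simp only [PartialJoin, SamePair]; omega) (by omega) (by omega) (by omega)
    refine h2.congr fun a b => ?_
    simp only [PartialJoin, SamePair]
    constructor
    · omega
    · rintro ⟨e1, e2, e3, e4, e5, e6, e7⟩
      by_cases h7 : a ≤ M + 3 ∧ b ≤ M + 3 ∨ M + 3 < a ∧ M + 3 < b ∨ a ≤ i ∨ b ≤ i
      · exact Or.inl (Or.inl ⟨e1, e2, e3, e4, e5, e6, h7⟩)
      · clear e6 ih
        simp only [not_or, not_and, not_le, not_lt] at h7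
        have h8 : (a = i + 1 ∨ a = i + 2) ∧ (b = M + 4 ∨ b = M + 5 ∨ b = M + 6) ∨
            (b = i + 1 ∨ b = i + 2) ∧ (a = M + 4 ∨ a = M + 5 ∨ a = M + 6) := by
          omega
        clear h7 e7 e1 e2 e3 e4 e5 h h1 h2
        rcases h8 with ⟨rfl | rfl, rfl | rfl | rfl⟩ | ⟨rfl | rfl, rfl | rfl | rfl⟩ <;> simp

end Extremal

section Extremal

variable {M : ℕ}

lemma Descending.step {z : ℕ} (hz : z = 0 ∨ z = 4 ∧ 4 ≤ M + 3)
    (h : Descending M (NearlyComplete (M + 3) z)) :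
    Descending (M + 3) (NearlyComplete (M + 6) z) := by
  have hj : Descending (M + 3) (PartialJoin (M + 3) z (M + 3)) := by
    have h1 := h.addVertex (x := 1) (y := 2) (by grind [NearlyComplete, SamePair])
    have h2 := h1.addVertex (x := M + 4) (y := 1)
      (by grind [NearlyComplete, SamePair])
    have h3 := h2.addVertex (x := M + 4) (y := M + 5)
      (by grind [NearlyComplete, SamePair])
    obtain ⟨d, hd | hd⟩ := Nat.even_or_odd' (M + 1)
    · refine Descending.partialJoin 2 d le_rfl (by omega) ?_
      have h4 := h3.addPath (u := 2) (v := M + 6) (w := M + 5) (x := 1)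
        (by grind [NearlyComplete, SamePair])
        (by grind [NearlyComplete, SamePair])
        (by grind [NearlyComplete, SamePair])
        (by grind [NearlyComplete, SamePair])
        (by grind [NearlyComplete, SamePair]) (by omega) (by omega) (by omega)
      refine h4.congr fun a b => ?_
      simp only [NearlyComplete, PartialJoin, SamePair]
      constructor
      · omega
      · rintro ⟨e1, e2, e3, e4, e5, e6, e7⟩
        by_cases h : a ≤ M + 3 ∧ b ≤ M + 3
        · iterate 4 apply Or.inl
          exact ⟨e1, e2, e3, h.1, h.2, e6⟩
        · clear e6 hz h1 h2 h3 h4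
          have h8 : (a = 1 ∨ a = 2) ∧ (b = M + 4 ∨ b = M + 5 ∨ b = M + 6) ∨
              (b = 1 ∨ b = 2) ∧ (a = M + 4 ∨ a = M + 5 ∨ a = M + 6) ∨
              (a = M + 4 ∨ a = M + 5 ∨ a = M + 6) ∧ (b = M + 4 ∨ b = M + 5 ∨ b = M + 6) := by
            omega
          clear h e7 e2 e3 e4 e5
          rcases h8 with ⟨rfl | rfl, rfl | rfl | rfl⟩ | ⟨rfl | rfl, rfl | rfl | rfl⟩ |
            ⟨rfl | rfl | rfl, rfl | rfl | rfl⟩ <;> simp at e1 ⊢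
    · refine Descending.partialJoin 3 d (by omega) (by omega) ?_
      have h4 := h3.addPath (u := 3) (v := M + 6) (w := M + 4) (x := 1)
        (by grind [NearlyComplete, SamePair])
        (by grind [NearlyComplete, SamePair])
        (by grind [NearlyComplete, SamePair])
        (by grind [NearlyComplete, SamePair])
        (by grind [NearlyComplete, SamePair]) (by omega) (by omega) (by omega)
      have h5 := h4.addPath (u := 2) (v := M + 5) (w := M + 6) (x := 3)
        (by grind [NearlyComplete, SamePair])
        (by grind [NearlyComplete, SamePair])
        (by grind [NearlyComplete, SamePair])
        (by grind [NearlyComplete, SamePair])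
        (by grind [NearlyComplete, SamePair]) (by omega) (by omega) (by omega)
      refine h5.congr fun a b => ?_
      simp only [NearlyComplete, PartialJoin, SamePair]
      constructor
      · omega
      · rintro ⟨e1, e2, e3, e4, e5, e6, e7⟩
        by_cases h : a ≤ M + 3 ∧ b ≤ M + 3
        · iterate 5 apply Or.inl
          exact ⟨e1, e2, e3, h.1, h.2, e6⟩
        · clear e6 hz h1 h2 h3 h4 h5
          have h8 : (a = 1 ∨ a = 2 ∨ a = 3) ∧ (b = M + 4 ∨ b = M + 5 ∨ b = M + 6) ∨
              (b = 1 ∨ b = 2 ∨ b = 3) ∧ (a = M + 4 ∨ a = M + 5 ∨ a = M + 6) ∨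
              (a = M + 4 ∨ a = M + 5 ∨ a = M + 6) ∧ (b = M + 4 ∨ b = M + 5 ∨ b = M + 6) := by
            omega
          clear h e7 e2 e3 e4 e5
          rcases h8 with ⟨rfl | rfl | rfl, rfl | rfl | rfl⟩ |
            ⟨rfl | rfl | rfl, rfl | rfl | rfl⟩ | ⟨rfl | rfl | rfl, rfl | rfl | rfl⟩ <;> simp at e1 ⊢
  refine hj.congr fun a b => ?_
  simp only [NearlyComplete, PartialJoin, SamePair]
  omega

lemma exists_descending_nearlyComplete (M : ℕ) : ∃ z, (z = 0 ∨ z = 4 ∧ 4 ≤ M + 3) ∧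
    Descending M (NearlyComplete (M + 3) z) := by
  induction M using Nat.strong_induction_on with
  | _ M ih =>
    have h0 : Descending 0 (NearlyComplete 3 0) := by
      refine ⟨0, realizable_triangle.congr fun a b => ?_, by omega⟩
      simp only [NearlyComplete, SamePair]
      omega
    match M, ih with
    | 0, _ => exact ⟨0, Or.inl rfl, h0⟩
    | 1, _ =>
      refine ⟨4, by omega, (h0.addVertex (x := 2) (y := 3)
        (by grind [NearlyComplete, SamePair])).congr fun a b => ?_⟩
      simp only [NearlyComplete, SamePair]
      omega
    | 2, _ =>
      have h1 := h0.addVertex (x := 1) (y := 2) (by grind [NearlyComplete, SamePair])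
      have h2 := h1.addVertex (x := 4) (y := 1) (by grind [NearlyComplete, SamePair])
      have h3 := h2.addPath (u := 5) (v := 3) (w := 2) (x := 4)
        (by grind [NearlyComplete, SamePair])
        (by grind [NearlyComplete, SamePair])
        (by grind [NearlyComplete, SamePair])
        (by grind [NearlyComplete, SamePair])
        (by grind [NearlyComplete, SamePair]) (by omega) (by omega) (by omega)
      refine ⟨0, Or.inl rfl, h3.congr fun a b => ?_⟩
      simp only [NearlyComplete, SamePair]
      constructor
      · omega
      · rintro ⟨e1, e2, e3, e4, e5, -⟩
        clear h0 h1 h2 h3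
        interval_cases a <;> interval_cases b <;> simp at e1 ⊢
    | M + 3, ih =>
      obtain ⟨z, hz, h⟩ := ih M (by omega)
      exact ⟨z, by omega, h.step hz⟩

lemma exists_realizable_of_three_mul_le {q : ℕ} (hq : 3 * q ≤ (M + 1).choose 2) :
    ∃ A, Realizable (M + 3) (2 * M + 3 + 3 * q) (M + 1 + 2 * q) A := by
  obtain ⟨z, -, Q, h, h'⟩ := exists_descending_nearlyComplete M
  have hQ := h.choose_two_le (x := 1) (y := z) fun a ha b hb hab hn => by
    rw [mem_Icc] at ha hb
    exact ⟨hab, ha.1, hb.1, ha.2, hb.2, hn⟩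
  have e1 := choose_two_succ (M + 1)
  have e2 := choose_two_succ (M + 2)
  rcases Nat.lt_or_ge q Q with hlt | hge
  · exact h' q hlt
  · obtain rfl : q = Q := by
      simp only [add_assoc, Nat.reduceAdd] at *
      omega
    exact ⟨_, h⟩

lemma exists_realizable_of_three_mul_le_of_le {a q : ℕ} (ha : a ≤ (M + 1).choose 2)
    (hq : 3 * q ≤ a) : ∃ A, Realizable (M + 3) (2 * M + 3 + a) (M + 1 + a - q) A := by
  obtain ⟨A, h⟩ := exists_realizable_of_three_mul_le (hq.trans ha)
  have e1 := choose_two_succ (M + 1)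
  have e2 := choose_two_succ (M + 2)
  simp only [add_assoc, Nat.reduceAdd] at e1 e2
  obtain ⟨A', h'⟩ := h.exists_addEdges (a - 3 * q) (by omega)
  refine ⟨A', ?_⟩
  convert h' using 1 <;> omega

end Extremal

/-- **Theorem 1.2.** `(1,h1,h2,h3)` is the `h`-vector of a `2`-dimensional Buchsbaum
complex iff it is obtained from a vector satisfying the conditions of Theorem 1.1 by
adding `(0, 3k, -3k, k)` for some integer `k ≥ 0`. -/
theorem stmt1 (K : Type) [Field K] (h1 h2 h3 : ℤ) :
    (∃ (n : ℕ) (Δ : Finset (Finset ℕ)), IsComplexOn n Δ ∧ dimZ Δ = 2 ∧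
        IsBuchsbaum K Δ ∧ hVector3 Δ 1 h1 h2 h3) ↔
      (∃ h1' h2' h3' k : ℤ,
        (0 ≤ h1' ∧ 0 ≤ h2' ∧ h2' ≤ (((h1' + 1).toNat.choose 2 : ℕ) : ℤ) ∧ -h2' ≤ 3 * h3' ∧ h3' ≤ ((macaulay2 h2'.toNat : ℕ) : ℤ)) ∧
        0 ≤ k ∧ h1 = h1' + 3 * k ∧ h2 = h2' - 3 * k ∧ h3 = h3' + k) := by
  constructor
  · rintro ⟨n, Δ, hΔ, hd, hB, hh⟩
    obtain ⟨k, a, M, rfl, he, ha, ht, hl⟩ := exists_of_isBuchsbaum hΔ hd hB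
    obtain ⟨-, rfl, rfl, rfl⟩ := (hVector3_iff hΔ 1 h1 h2 h3).mp hh
    refine ⟨M, a, #(facesOf Δ 3) - #(facesOf Δ 2) + (M + 3 * (k + 1) : ℕ) - 1 - k, k, ?_⟩
    rw [show ((M : ℤ) + 1).toNat = M + 1 by omega, Int.toNat_natCast]
    push_cast
    omega
  · rintro ⟨h1', h2', h3', k, ⟨hh1, hh2, hC, hl, hu⟩, hk, rfl, rfl, rfl⟩
    obtain ⟨M, rfl⟩ := Int.eq_ofNat_of_zero_le hh1
    obtain ⟨a, rfl⟩ := Int.eq_ofNat_of_zero_le hh2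
    obtain ⟨k, rfl⟩ := Int.eq_ofNat_of_zero_le hk
    have ha : a ≤ (M + 1).choose 2 := by exact_mod_cast hC
    rw [Int.toNat_natCast] at hu
    obtain ⟨t, A, ht, hA⟩ : ∃ (t : ℕ) (A : ℕ → ℕ → Prop), (t : ℤ) = h3' + M + a + 1 ∧
        Realizable (M + 3) (2 * M + 3 + a) t A := by
      rcases le_or_gt 0 h3' with hs | hs
      · obtain ⟨h, rfl⟩ := Int.eq_ofNat_of_zero_le hs
        obtain ⟨A, hA⟩ := exists_realizable_of_le_macaulay2 (h := h) ha (by exact_mod_cast hu)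
        exact ⟨_, A, by push_cast; ring, hA⟩
      · obtain ⟨q, hq⟩ := Int.eq_ofNat_of_zero_le (show 0 ≤ -h3' by omega)
        obtain ⟨A, hA⟩ := exists_realizable_of_three_mul_le_of_le (q := q) ha (by omega)
        exact ⟨_, A, by omega, hA⟩
    obtain ⟨T, hT, -, -, he, rfl⟩ := hA
    obtain ⟨T', hT', he', ht'⟩ := hT.disjointTriangles k
    obtain ⟨Δ, hΔ, hd, hB, hfe, hft⟩ := hT'.exists_isBuchsbaum K (by omega)
    refine ⟨_, Δ, hΔ, hd, hB, (hVector3_iff hΔ _ _ _ _).mpr ?_⟩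
    rw [hfe, hft, he', ht', he]
    push_cast
    exact ⟨trivial, by omega⟩
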